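/- arXiv:0802.1240 — 10 statements merged into one kernel-verified Lean document; each statement's English description precedes it below -/
import Mathlib

section
/- Let Ω be a complete separable metric space and 𝒫 a nonempty family of Borel probability measures on Ω, with capacity c(A) := sup_{P∈𝒫} P(A). Then 𝒫 is relatively compact in the topology of weak convergence if and only if for every decreasing sequence of closed sets F_n with ⋂_n F_n = ∅, one has c(F_n) ↓ 0. -/
open MeasureTheory Filter Topology ENNReal

/-- The upper envelope of a tight set of measures vanishes along every decreasing sequence of
closed sets with empty intersection. -/
theorem MeasureTheory.IsTightMeasureSet.tendsto_iSup_measure_isClosed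
    {Ω : Type*} [TopologicalSpace Ω] [MeasurableSpace Ω] {S : Set (Measure Ω)}
    (hS : IsTightMeasureSet S) {F : ℕ → Set Ω} (hF : ∀ n, IsClosed (F n)) (hanti : Antitone F)
    (hempty : (⋂ n, F n) = ∅) :
    Tendsto (fun n => ⨆ μ ∈ S, μ (F n)) atTop (𝓝 0) := by
  rw [ENNReal.tendsto_atTop_zero]
  intro ε hε
  obtain ⟨K, hK, hKε⟩ := isTightMeasureSet_iff_exists_isCompact_measure_compl_le.1 hS ε hε
  obtain ⟨N, hN⟩ := hK.elim_directed_family_closed F hF (by simp [hempty])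
    hanti.directed_ge
  refine ⟨N, fun n hn => iSup₂_le fun μ hμ => (measure_mono fun x hx hxK => ?_).trans (hKε μ hμ)⟩
  exact hN.subset ⟨hxK, hanti hn hx⟩

/-- A set of measures on a complete separable space whose upper envelope vanishes along decreasing
sequences of closed sets with empty intersection is tight. -/
theorem MeasureTheory.isTightMeasureSet_of_tendsto_iSup_measure_isClosed
    {Ω : Type*} [PseudoMetricSpace Ω] [CompleteSpace Ω] [TopologicalSpace.SeparableSpace Ω]
    [MeasurableSpace Ω] {S : Set (Measure Ω)}
    (h : ∀ F : ℕ → Set Ω, (∀ n, IsClosed (F n)) → Antitone F → (⋂ n, F n) = ∅ →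
      Tendsto (fun n => ⨆ μ ∈ S, μ (F n)) atTop (𝓝 0)) :
    IsTightMeasureSet S := by
  rw [isTightMeasureSet_iff_exists_isCompact_measure_compl_le]
  intro ε hε
  cases isEmpty_or_nonempty Ω
  · exact ⟨∅, isCompact_empty, fun μ _ => by simp [Set.eq_empty_of_isEmpty]⟩
  obtain ⟨D, hD⟩ := TopologicalSpace.exists_dense_seq Ω
  obtain ⟨u, -, hu_pos, hu⟩ := exists_seq_strictAnti_tendsto (0 : ℝ)
  obtain ⟨δ, hδ_pos, hδ⟩ := ENNReal.exists_pos_sum_of_countable' hε.ne' ℕ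
  have exists_cover (m : ℕ) : ∃ k, ∀ μ ∈ S, μ (⋃ i ≤ k, Metric.ball (D i) (u m))ᶜ ≤ δ m := by
    have hlim := h (fun k => (⋃ i ≤ k, Metric.ball (D i) (u m))ᶜ)
      (fun k => (isOpen_biUnion fun i _ => Metric.isOpen_ball).isClosed_compl)
      (fun k l hkl => Set.compl_subset_compl.2 <|
        Set.biUnion_subset_biUnion_left fun i (hi : i ≤ k) => hi.trans hkl)
      (by
        rw [← Set.compl_iUnion, Set.compl_empty_iff, Set.eq_univ_iff_forall]
        intro x
        obtain ⟨i, hi⟩ := hD.exists_dist_lt x (hu_pos m)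
        exact Set.mem_iUnion.2 ⟨i, Set.mem_iUnion₂.2 ⟨i, le_rfl, hi⟩⟩)
    obtain ⟨k, hk⟩ := ENNReal.tendsto_atTop_zero.1 hlim (δ m) (hδ_pos m)
    exact ⟨k, fun μ hμ => (le_iSup₂_of_le μ hμ le_rfl).trans (hk k le_rfl)⟩
  choose k hk using exists_cover
  refine ⟨⋂ m, ⋃ i ∈ Set.Iic (k m), Metric.closedBall (D i) (u m),
    TotallyBounded.isCompact_of_isClosed ?_ ?_, fun μ hμ => ?_⟩
  · refine Metric.totallyBounded_iff.2 fun r hr => ?_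
    obtain ⟨m, hm⟩ := (hu.eventually_lt_const hr).exists
    refine ⟨D '' Set.Iic (k m), (Set.finite_Iic _).image _, ?_⟩
    rw [Set.biUnion_image]
    exact (Set.iInter_subset _ m).trans <|
      Set.iUnion₂_mono fun i _ => Metric.closedBall_subset_ball hm
  · exact isClosed_iInter fun m =>
      (Set.finite_Iic _).isClosed_biUnion fun i _ => Metric.isClosed_closedBall
  · rw [Set.compl_iInter]
    calc μ (⋃ m, (⋃ i ∈ Set.Iic (k m), Metric.closedBall (D i) (u m))ᶜ)
        ≤ ∑' m, μ (⋃ i ∈ Set.Iic (k m), Metric.closedBall (D i) (u m))ᶜ := measure_iUnion_le _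
      _ ≤ ∑' m, δ m := ENNReal.tsum_le_tsum fun m => (measure_mono <| Set.compl_subset_compl.2 <|
          Set.iUnion₂_mono fun i _ => Metric.ball_subset_closedBall).trans (hk m μ hμ)
      _ ≤ ε := hδ.le

/-- A nonempty family `Ps` of Borel probability measures on a complete
separable metric space is relatively compact for the topology of weak convergence if and
only if for every decreasing sequence of closed sets `Fₙ` with `⋂ₙ Fₙ = ∅` one has
`c(Fₙ) ↓ 0`, where `c(A) = sup_{P ∈ Ps} P(A)`. -/
theorem relatively_compact_iff_closed_seq
    {Ω : Type*} [MetricSpace Ω] [CompleteSpace Ω] [TopologicalSpace.SeparableSpace Ω]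
    [MeasurableSpace Ω] [BorelSpace Ω]
    (Ps : Set (ProbabilityMeasure Ω)) (hPs : Ps.Nonempty)
    (c : Set Ω → ℝ≥0∞)
    (hc : ∀ A : Set Ω, c A = ⨆ P ∈ Ps, (P : Measure Ω) A) :
    IsCompact (closure Ps) ↔
      ∀ F : ℕ → Set Ω, (∀ n, IsClosed (F n)) → Antitone F → (⋂ n, F n) = ∅ →
        Tendsto (fun n => c (F n)) atTop (𝓝 0) := by
  have hc' (A : Set Ω) :
      c A = ⨆ μ ∈ {((P : ProbabilityMeasure Ω) : Measure Ω) | P ∈ Ps}, μ A := by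
    rw [hc]
    simp [iSup_and, iSup_comm (ι := Measure Ω)]
  simp only [hc']
  have : SecondCountableTopology Ω := UniformSpace.secondCountable_of_separable Ω
  exact ⟨fun h F hF hanti hempty =>
      (isTightMeasureSet_of_isCompact_closure h).tendsto_iSup_measure_isClosed hF hanti hempty,
    fun h => isCompact_closure_of_isTightMeasureSet
      (isTightMeasureSet_of_tendsto_iSup_measure_isClosed h)⟩
end

section
/- Let Ω be a complete separable metric space and 𝒫 a nonempty family of Borel probability measures on Ω that is compact in the topology of weak convergence, with capacity c(A) := sup_{P∈𝒫} P(A). Then for every decreasing sequence of closed sets F_n with F_n ↓ F = ⋂_n F_n, one has c(F_n) ↓ c(F). -/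
open MeasureTheory Filter Topology ENNReal

/-- A strict upper bound for the probability of a closed set at `P` persists near `P`. -/
lemma MeasureTheory.ProbabilityMeasure.eventually_measure_lt_of_isClosed
    {Ω : Type*} [TopologicalSpace Ω] [MeasurableSpace Ω] [OpensMeasurableSpace Ω]
    [HasOuterApproxClosed Ω] {P : ProbabilityMeasure Ω} {A : Set Ω} (hA : IsClosed A)
    {b : ℝ≥0∞} (hb : (P : Measure Ω) A < b) :
    ∀ᶠ Q : ProbabilityMeasure Ω in 𝓝 P, (Q : Measure Ω) A < b :=
  eventually_lt_of_limsup_lt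
    ((ProbabilityMeasure.limsup_measure_closed_le_of_tendsto tendsto_id hA).trans_lt hb)

/-- A Dini-type property: if all members of a weakly compact family give mass less than `b` to
the intersection of a decreasing sequence of closed sets, then some set of the sequence has mass
less than `b` simultaneously for all members. -/
lemma IsCompact.exists_forall_measure_lt_of_antitone_isClosed
    {Ω : Type*} [TopologicalSpace Ω] [MeasurableSpace Ω] [OpensMeasurableSpace Ω]
    [HasOuterApproxClosed Ω] {Ps : Set (ProbabilityMeasure Ω)} (hPs : IsCompact Ps)
    {F : ℕ → Set Ω} (hF : ∀ n, IsClosed (F n)) (hmono : Antitone F) {b : ℝ≥0∞}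
    (hb : ∀ P ∈ Ps, (P : Measure Ω) (⋂ n, F n) < b) :
    ∃ n, ∀ P ∈ Ps, (P : Measure Ω) (F n) < b := by
  refine hPs.induction_on (p := fun s => ∃ n, ∀ P ∈ s, (P : Measure Ω) (F n) < b)
    ⟨0, by simp⟩ (fun s t hst ⟨n, hn⟩ => ⟨n, fun P hP => hn P (hst hP)⟩) ?_ ?_
  · rintro s t ⟨m, hm⟩ ⟨n, hn⟩
    refine ⟨max m n, fun P hP => ?_⟩
    rcases hP with hP | hP
    · exact (measure_mono (hmono (le_max_left m n))).trans_lt (hm P hP)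
    · exact (measure_mono (hmono (le_max_right m n))).trans_lt (hn P hP)
  · intro P hP
    have hlim : Tendsto (fun n => (P : Measure Ω) (F n)) atTop
        (𝓝 ((P : Measure Ω) (⋂ n, F n))) :=
      tendsto_measure_iInter_atTop (fun n => (hF n).measurableSet.nullMeasurableSet) hmono
        ⟨0, MeasureTheory.measure_ne_top _ _⟩
    obtain ⟨n, hn⟩ := (hlim.eventually_lt_const (hb P hP)).exists
    exact ⟨_, mem_nhdsWithin_of_mem_nhds
      (ProbabilityMeasure.eventually_measure_lt_of_isClosed (hF n) hn), n, fun Q hQ => hQ⟩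

/-- If the nonempty family `Ps` of Borel probability measures on a
complete separable metric space is weakly compact, then for every decreasing sequence of
closed sets `Fₙ ↓ F = ⋂ₙ Fₙ` one has `c(Fₙ) ↓ c(F)`, where `c(A) = sup_{P ∈ Ps} P(A)`. -/
theorem capacity_cont_on_decreasing_closed
    {Ω : Type*} [MetricSpace Ω] [CompleteSpace Ω] [TopologicalSpace.SeparableSpace Ω]
    [MeasurableSpace Ω] [BorelSpace Ω]
    (Ps : Set (ProbabilityMeasure Ω)) (hPs : Ps.Nonempty)
    (hcompact : IsCompact Ps)
    (c : Set Ω → ℝ≥0∞)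
    (hc : ∀ A : Set Ω, c A = ⨆ P ∈ Ps, (P : Measure Ω) A)
    (F : ℕ → Set Ω) (hF : ∀ n, IsClosed (F n)) (hmono : Antitone F) :
    Tendsto (fun n => c (F n)) atTop (𝓝 (c (⋂ n, F n))) := by
  have hcmono : Monotone c := fun A B hAB => by
    simpa only [hc] using iSup₂_mono fun P _ => measure_mono hAB
  refine tendsto_order.2 ⟨fun a ha => .of_forall fun n =>
    ha.trans_le (hcmono (Set.iInter_subset F n)), fun b hb => ?_⟩
  obtain ⟨d, hd, hdb⟩ := exists_between hb
  have hlt : ∀ P ∈ Ps, (P : Measure Ω) (⋂ n, F n) < d := fun P hP =>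
    (le_iSup₂ (f := fun (P : ProbabilityMeasure Ω) (_ : P ∈ Ps) =>
      (P : Measure Ω) (⋂ n, F n)) P hP).trans_lt (hc _ ▸ hd)
  obtain ⟨n, hn⟩ := hcompact.exists_forall_measure_lt_of_antitone_isClosed hF hmono hlt
  filter_upwards [eventually_ge_atTop n] with m hm
  calc c (F m) ≤ c (F n) := hcmono (hmono hm)
    _ ≤ d := by rw [hc]; exact iSup₂_le fun P hP => (hn P hP).le
    _ < b := hdb
end

section
/- Let Ω be a complete separable metric space, 𝒫 a nonempty family of Borel probability measures on Ω, and 𝔼[X] := sup_{P∈𝒫} E_P[X] the upper expectation. Then 𝔼 is regular (i.e. for every sequence (X_n) of bounded continuous functions on Ω with X_n ↓ 0 pointwise on Ω one has 𝔼[X_n] ↓ 0) if and only if 𝒫 is relatively compact in the topology of weak convergence of probability measures. -/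
open MeasureTheory Filter Topology ENNReal BoundedContinuousFunction

section InfDist

variable {Ω : Type*} [PseudoMetricSpace Ω]

/-- The distance to `s`, truncated at `1`, as a bounded continuous function. -/
noncomputable def truncInfDist (s : Set Ω) : Ω →ᵇ ℝ :=
  BoundedContinuousFunction.ofNormedAddCommGroup (fun ω => min 1 (Metric.infDist ω s))
    (continuous_const.min (Metric.continuous_infDist_pt s)) 1 fun ω => by
      rw [Real.norm_of_nonneg (le_min zero_le_one Metric.infDist_nonneg)]
      exact min_le_left _ _

lemma truncInfDist_apply (s : Set Ω) (ω : Ω) :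
    truncInfDist s ω = min 1 (Metric.infDist ω s) := rfl

lemma truncInfDist_nonneg (s : Set Ω) (ω : Ω) : 0 ≤ truncInfDist s ω :=
  le_min zero_le_one Metric.infDist_nonneg

lemma antitone_truncInfDist_image_Iic (D : ℕ → Ω) (ω : Ω) :
    Antitone fun n => truncInfDist (D '' Set.Iic n) ω := fun _ _ h =>
  min_le_min_left _ <| Metric.infDist_le_infDist_of_subset
    (Set.image_mono (Set.Iic_subset_Iic.2 h)) (Set.nonempty_Iic.image D)

lemma tendsto_truncInfDist_image_Iic {D : ℕ → Ω} (hD : DenseRange D) (ω : Ω) :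
    Tendsto (fun n => truncInfDist (D '' Set.Iic n) ω) atTop (𝓝 0) := by
  refine tendsto_order.2 ⟨fun a ha => .of_forall fun n => ha.trans_le (truncInfDist_nonneg _ _),
    fun a ha => ?_⟩
  obtain ⟨i, hi⟩ := hD.exists_dist_lt ω ha
  filter_upwards [eventually_ge_atTop i] with n hn
  rw [truncInfDist_apply]
  have hmem : D i ∈ D '' Set.Iic n := Set.mem_image_of_mem D (Set.mem_Iic.2 hn)
  exact (min_le_right _ _).trans_lt ((Metric.infDist_le_dist_of_mem hmem).trans_lt hi)

/-- A set that lies, at every scale, close to some finite set is totally bounded. -/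
lemma totallyBounded_iInter_truncInfDist_le {F : ℕ → Set Ω} (hF : ∀ m, (F m).Finite)
    (hne : ∀ m, (F m).Nonempty) {δ : ℕ → ℝ} (hδ1 : ∀ m, δ m < 1)
    (hδ : Tendsto δ atTop (𝓝 0)) :
    TotallyBounded (⋂ m, {ω | truncInfDist (F m) ω ≤ δ m}) := by
  refine Metric.totallyBounded_iff.2 fun r hr => ?_
  obtain ⟨m, hm⟩ := (hδ.eventually_lt_const hr).exists
  refine ⟨F m, hF m, fun ω hω => ?_⟩
  have h : min 1 (Metric.infDist ω (F m)) ≤ δ m := Set.mem_iInter.1 hω m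
  have h' : Metric.infDist ω (F m) < r :=
    ((min_le_iff.1 h).resolve_left (hδ1 m).not_ge).trans_lt hm
  obtain ⟨y, hy, hlt⟩ := (Metric.infDist_lt_iff (hne m)).1 h'
  exact Set.mem_iUnion₂.2 ⟨y, hy, hlt⟩

end InfDist

section UpperExpectation

variable {Ω : Type*} [TopologicalSpace Ω] [MeasurableSpace Ω] [OpensMeasurableSpace Ω]

lemma integral_le_upperExpectation (Ps : Set (ProbabilityMeasure Ω)) (X : Ω →ᵇ ℝ)
    {P : ProbabilityMeasure Ω} (hP : P ∈ Ps) :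
    ∫ ω, X ω ∂(P : Measure Ω) ≤ ⨆ Q : Ps, ∫ ω, X ω ∂(Q.1 : Measure Ω) := by
  refine le_ciSup (f := fun Q : Ps => ∫ ω, X ω ∂(Q.1 : Measure Ω)) ⟨‖X‖, ?_⟩ ⟨P, hP⟩
  rintro _ ⟨Q, rfl⟩
  exact (le_abs_self _).trans (X.norm_integral_le_norm (Q.1 : Measure Ω))

/-- The upper expectation of a family with compact closure is continuous from above on bounded
continuous functions. -/
lemma tendsto_upperExpectation_of_isCompact_closure {Ps : Set (ProbabilityMeasure Ω)}
    (hPs : Ps.Nonempty) (hc : IsCompact (closure Ps)) {X : ℕ → (Ω →ᵇ ℝ)}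
    (hX : ∀ ω, Antitone fun n => X n ω)
    (hX0 : ∀ ω, Tendsto (fun n => X n ω) atTop (𝓝 0)) :
    Tendsto (fun n => ⨆ P : Ps, ∫ ω, X n ω ∂(P.1 : Measure Ω)) atTop (𝓝 0) := by
  have hnonneg : ∀ n ω, 0 ≤ X n ω := fun n ω => (hX ω).le_of_tendsto (hX0 ω) n
  have hunif : TendstoUniformlyOn
      (fun n (P : ProbabilityMeasure Ω) => ∫ ω, X n ω ∂(P : Measure Ω)) (fun _ => (0 : ℝ))
      atTop (closure Ps) := by
    refine Antitone.tendstoUniformlyOn_of_forall_tendsto hc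
      (fun n =>
        (ProbabilityMeasure.continuous_integral_boundedContinuousFunction (X n)).continuousOn)
      (fun P _ i j hij => integral_mono ((X j).integrable _) ((X i).integrable _)
        fun ω => hX ω hij)
      continuousOn_const fun P _ => ?_
    simpa using tendsto_integral_of_dominated_convergence (μ := (P : Measure Ω))
      (F := fun n ω => X n ω) (f := fun _ => (0 : ℝ)) (X 0)
      (fun n => ((X n).integrable _).aestronglyMeasurable) ((X 0).integrable _)
      (fun n => .of_forall fun ω => by
        rw [Real.norm_of_nonneg (hnonneg n ω)]
        exact hX ω n.zero_le)
      (.of_forall hX0)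
  have : Nonempty Ps := hPs.to_subtype
  refine tendsto_order.2 ⟨fun a ha => .of_forall fun n => ha.trans_le <|
    Real.iSup_nonneg fun P => integral_nonneg (hnonneg n), fun a ha => ?_⟩
  filter_upwards [Metric.tendstoUniformlyOn_iff.1 hunif (a / 2) (half_pos ha)] with n hn
  refine (ciSup_le fun P => ?_).trans_lt (half_lt_self ha)
  have h := hn P.1 (subset_closure P.2)
  rw [dist_zero_left] at h
  exact (le_abs_self _).trans h.le

end UpperExpectation

/-- A family of probability measures on a complete separable metric space whose upper expectation
is continuous from above on bounded continuous functions is tight. -/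
lemma isTightMeasureSet_of_upperExpectation_regular
    {Ω : Type*} [PseudoMetricSpace Ω] [CompleteSpace Ω] [TopologicalSpace.SeparableSpace Ω]
    [MeasurableSpace Ω] [OpensMeasurableSpace Ω] [Nonempty Ω]
    {Ps : Set (ProbabilityMeasure Ω)}
    (h : ∀ X : ℕ → (Ω →ᵇ ℝ),
      (∀ ω, Antitone fun n => X n ω) →
      (∀ ω, Tendsto (fun n => X n ω) atTop (𝓝 0)) →
      Tendsto (fun n => ⨆ P : Ps, ∫ ω, X n ω ∂(P.1 : Measure Ω)) atTop (𝓝 0)) :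
    IsTightMeasureSet {((P : ProbabilityMeasure Ω) : Measure Ω) | P ∈ Ps} := by
  refine isTightMeasureSet_iff_exists_isCompact_measure_compl_le.2 fun ε hε => ?_
  obtain ⟨D, hD⟩ := TopologicalSpace.exists_dense_seq Ω
  have hlim := h _ (antitone_truncInfDist_image_Iic D) (tendsto_truncInfDist_image_Iic hD)
  obtain ⟨η, hη, hηε⟩ := ENNReal.exists_pos_sum_of_countable hε.ne' ℕ
  set δ : ℕ → ℝ := fun m => (1 / 2) ^ (m + 1)
  have hδpos : ∀ m, 0 < δ m := fun m => by positivity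
  have hδ1 : ∀ m, δ m < 1 := fun m =>
    pow_lt_one₀ (by norm_num) (by norm_num) m.succ_ne_zero
  have hδ : Tendsto δ atTop (𝓝 0) :=
    (_root_.tendsto_pow_atTop_nhds_zero_of_lt_one (r := (1 / 2 : ℝ)) (by norm_num)
      (by norm_num)).comp (tendsto_add_atTop_nat 1)
  choose N hN using fun m =>
    (hlim.eventually_lt_const (mul_pos (hδpos m) (NNReal.coe_pos.2 (hη m)))).exists
  refine ⟨⋂ m, {ω | truncInfDist (D '' Set.Iic (N m)) ω ≤ δ m}, ?_, ?_⟩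
  · exact (totallyBounded_iInter_truncInfDist_le (fun m => (Set.finite_Iic _).image D)
      (fun m => Set.nonempty_Iic.image D) hδ1 hδ).isCompact_of_isClosed
      (isClosed_iInter fun m => isClosed_le (truncInfDist _).continuous continuous_const)
  · rintro _ ⟨P, hP, rfl⟩
    rw [Set.compl_iInter]
    refine (measure_iUnion_le _).trans ((ENNReal.tsum_le_tsum fun m => ?_).trans hηε.le)
    have hmarkov := mul_meas_ge_le_integral_of_nonneg (μ := (P : Measure Ω))
      (.of_forall (truncInfDist_nonneg (D '' Set.Iic (N m)))) ((truncInfDist _).integrable _) (δ m)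
    have hreal : (P : Measure Ω).real {ω | δ m ≤ truncInfDist (D '' Set.Iic (N m)) ω} ≤ η m :=
      le_of_mul_le_mul_left
        (hmarkov.trans ((integral_le_upperExpectation Ps _ hP).trans (hN m).le)) (hδpos m)
    have hsub : {ω | truncInfDist (D '' Set.Iic (N m)) ω ≤ δ m}ᶜ ⊆
        {ω | δ m ≤ truncInfDist (D '' Set.Iic (N m)) ω} := by
      intro ω hω
      simp only [Set.mem_compl_iff, Set.mem_ofPred_eq, not_le] at hω ⊢
      exact hω.le
    refine (measure_mono hsub).trans ?_
    rw [← ENNReal.ofReal_coe_nnreal, ← ofReal_measureReal]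
    exact ENNReal.ofReal_le_ofReal hreal

/-- The upper expectation `𝔼[X] = sup_{P ∈ Ps} E_P[X]` of a nonempty
family of Borel probability measures on a complete separable metric space is regular
(i.e. `𝔼[Xₙ] ↓ 0` for every sequence of bounded continuous functions `Xₙ ↓ 0` pointwise)
if and only if `Ps` is relatively compact in the topology of weak convergence. -/
theorem regular_iff_relatively_compact
    {Ω : Type*} [MetricSpace Ω] [CompleteSpace Ω] [TopologicalSpace.SeparableSpace Ω]
    [MeasurableSpace Ω] [BorelSpace Ω]
    (Ps : Set (ProbabilityMeasure Ω)) (hPs : Ps.Nonempty) :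
    (∀ X : ℕ → (Ω →ᵇ ℝ),
      (∀ ω, Antitone fun n => X n ω) →
      (∀ ω, Tendsto (fun n => X n ω) atTop (𝓝 0)) →
      Tendsto (fun n => ⨆ P : Ps, ∫ ω, X n ω ∂(P.1 : Measure Ω)) atTop (𝓝 0)) ↔
    IsCompact (closure Ps) := by
  obtain ⟨P, hP⟩ := hPs
  have : Nonempty Ω := (P : Measure Ω).nonempty_of_neZero
  exact ⟨fun h => isCompact_closure_of_isTightMeasureSet
      (isTightMeasureSet_of_upperExpectation_regular h),
    fun hc _ hX hX0 => tendsto_upperExpectation_of_isCompact_closure ⟨P, hP⟩ hc hX hX0⟩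
end

section
/- Let Ω be a complete separable metric space, 𝒫 a nonempty family of Borel probability measures on Ω, and p ≥ 1. For Borel functions X define ‖X‖_p := (sup_{P∈𝒫} E_P[|X|^p])^{1/p}. If (X_n) is a sequence of Borel functions with ‖X_n‖_p < ∞ for each n which is Cauchy with respect to ‖·‖_p (i.e. ‖X_n − X_m‖_p → 0 as n, m → ∞), then there exists a Borel function X with ‖X‖_p < ∞ such that ‖X_n − X‖_p → 0. (Thus the space 𝕃^p of equivalence classes of Borel functions with ‖X‖_p < ∞, modulo equality quasi-surely, is a Banach space under ‖·‖_p.) -/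
open MeasureTheory Filter Topology ENNReal

/-- The `𝕃^p` norm `‖X‖_p = (sup_{P ∈ Ps} E_P[|X|^p])^{1/p}` associated to a family of
probability measures `Ps`, with values in `ℝ≥0∞`. -/
noncomputable def upperLpNorm {Ω : Type*} [MeasurableSpace Ω]
    (Ps : Set (MeasureTheory.ProbabilityMeasure Ω)) (p : ℝ) (X : Ω → ℝ) : ℝ≥0∞ :=
  (⨆ P ∈ Ps, ∫⁻ ω, ENNReal.ofReal (|X ω| ^ p) ∂(P : Measure Ω)) ^ (1 / p)

/-- The upper norm is the supremum of the `L^p` seminorms over the family of measures. -/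
theorem upperLpNorm_eq_iSup_eLpNorm {Ω : Type*} [MeasurableSpace Ω]
    (Ps : Set (ProbabilityMeasure Ω)) {p : ℝ} (hp : 0 < p) (X : Ω → ℝ) :
    upperLpNorm Ps p X = ⨆ P ∈ Ps, eLpNorm X (ENNReal.ofReal p) (P : Measure Ω) := by
  have h (x : ℝ≥0∞) : x ^ (1 / p) = ENNReal.orderIsoRpow (1 / p) (one_div_pos.2 hp) x := rfl
  rw [upperLpNorm, h]
  simp only [OrderIso.map_iSup]
  refine iSup_congr fun P => iSup_congr fun _ => ?_
  rw [← h, eLpNorm_eq_lintegral_rpow_enorm_toReal (by simpa using hp) ENNReal.ofReal_ne_top,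
    ENNReal.toReal_ofReal hp.le]
  simp only [Real.enorm_eq_ofReal_abs, ENNReal.ofReal_rpow_of_nonneg (abs_nonneg _) hp.le]

/-- For `p ≥ 1`, every Cauchy sequence of Borel functions for the norm
`‖X‖_p = (sup_{P ∈ Ps} E_P[|X|^p])^{1/p}` converges in this norm to a Borel function with
finite norm; i.e. `𝕃^p` is complete. -/
theorem upperLp_complete
    {Ω : Type*} [MetricSpace Ω] [CompleteSpace Ω] [TopologicalSpace.SeparableSpace Ω]
    [MeasurableSpace Ω] [BorelSpace Ω]
    (Ps : Set (ProbabilityMeasure Ω)) (hPs : Ps.Nonempty)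
    (p : ℝ) (hp : 1 ≤ p)
    (X : ℕ → Ω → ℝ) (hXmeas : ∀ n, Measurable (X n))
    (hXfin : ∀ n, upperLpNorm Ps p (X n) < ⊤)
    (hCauchy : ∀ ε : ℝ≥0∞, 0 < ε → ∃ N : ℕ, ∀ m n : ℕ, N ≤ m → N ≤ n →
      upperLpNorm Ps p (fun ω => X n ω - X m ω) < ε) :
    ∃ Y : Ω → ℝ, Measurable Y ∧ upperLpNorm Ps p Y < ⊤ ∧
      Tendsto (fun n => upperLpNorm Ps p (fun ω => X n ω - Y ω)) atTop (𝓝 0) := by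
  have hp0 : 0 < p := zero_lt_one.trans_le hp
  have hq : 1 ≤ ENNReal.ofReal p := by simpa using hp
  simp only [upperLpNorm_eq_iSup_eLpNorm Ps hp0] at hXfin hCauchy ⊢
  have hB (k : ℕ) : ∃ N : ℕ, ∀ n ≥ N, ∀ m ≥ N, ∀ P ∈ Ps,
      eLpNorm (X n - X m) (ENNReal.ofReal p) (P : Measure Ω) < 2⁻¹ ^ k := by
    obtain ⟨N, hN⟩ := hCauchy (2⁻¹ ^ k) (ENNReal.pow_pos (by simp) k)
    exact ⟨N, fun n hn m hm P hP => (le_iSup₂ (f := fun (P : ProbabilityMeasure Ω) (_ : P ∈ Ps) =>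
      eLpNorm (X n - X m) (ENNReal.ofReal p) (P : Measure Ω)) P hP).trans_lt (hN m n hm hn)⟩
  obtain ⟨φ, hφ, hφB⟩ := extraction_forall_of_eventually fun k => eventually_atTop.2
    ((hB k).imp fun N hN n hn m (hm : n ≤ m) m' (hm' : n ≤ m') =>
      hN m (hn.trans hm) m' (hn.trans hm'))
  obtain ⟨Y, hY, hYlim⟩ : ∃ Y : Ω → ℝ, Measurable Y ∧
      ∀ ω, (∃ l, Tendsto (fun k => X (φ k) ω) atTop (𝓝 l)) →
        Tendsto (fun k => X (φ k) ω) atTop (𝓝 (Y ω)) :=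
    ⟨fun ω => limUnder atTop fun k => X (φ k) ω,
      (StronglyMeasurable.limUnder fun k => (hXmeas (φ k)).stronglyMeasurable).measurable,
      fun _ => tendsto_nhds_limUnder⟩
  have hae (P : ProbabilityMeasure Ω) (hP : P ∈ Ps) :
      ∀ᵐ ω ∂(P : Measure Ω), Tendsto (fun k => X (φ k) ω) atTop (𝓝 (Y ω)) := by
    refine (Lp.ae_tendsto_of_cauchy_eLpNorm (fun k => (hXmeas (φ k)).aestronglyMeasurable) hq
      (B := fun k => 2⁻¹ ^ k) ?_ fun k n m hn hm => ?_).mono hYlim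
    · exact (tsum_geometric_lt_top.2 (by simp)).ne
    · exact hφB k _ (hφ.monotone hn) _ (hφ.monotone hm) P hP
  have hlim (ε : ℝ≥0∞) (hε : 0 < ε) : ∃ N : ℕ, ∀ n ≥ N,
      ⨆ P ∈ Ps, eLpNorm (X n - Y) (ENNReal.ofReal p) (P : Measure Ω) ≤ ε := by
    obtain ⟨N, hN⟩ := hCauchy ε hε
    refine ⟨N, fun n hn => iSup₂_le fun P hP => ?_⟩
    refine (Lp.eLpNorm_lim_le_liminf_eLpNorm
      (fun k => ((hXmeas n).sub (hXmeas (φ k))).aestronglyMeasurable) (X n - Y)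
      ((hae P hP).mono fun ω hω => tendsto_const_nhds.sub hω)).trans ?_
    refine liminf_le_of_frequently_le' (Eventually.frequently ?_)
    filter_upwards [hφ.tendsto_atTop.eventually_ge_atTop N] with k hk
    exact (le_iSup₂ (f := fun (P : ProbabilityMeasure Ω) (_ : P ∈ Ps) =>
      eLpNorm (X n - X (φ k)) (ENNReal.ofReal p) (P : Measure Ω)) P hP).trans (hN _ n hk hn).le
  refine ⟨Y, hY, ?_, ENNReal.tendsto_atTop_zero.2 fun ε hε => hlim ε hε⟩
  obtain ⟨N, hN⟩ := hlim 1 zero_lt_one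
  refine lt_of_le_of_lt (iSup₂_le fun P hP => ?_) (ENNReal.add_lt_top.2 ⟨hXfin N, one_lt_top⟩)
  calc eLpNorm Y (ENNReal.ofReal p) (P : Measure Ω)
      = eLpNorm (X N - (X N - Y)) (ENNReal.ofReal p) (P : Measure Ω) := by
        congr 1; ring
    _ ≤ eLpNorm (X N) (ENNReal.ofReal p) (P : Measure Ω)
        + eLpNorm (X N - Y) (ENNReal.ofReal p) (P : Measure Ω) :=
      eLpNorm_sub_le (hXmeas N).aestronglyMeasurable
        ((hXmeas N).sub hY).aestronglyMeasurable hq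
    _ ≤ _ := add_le_add
      (le_iSup₂ (f := fun (P : ProbabilityMeasure Ω) (_ : P ∈ Ps) =>
        eLpNorm (X N) (ENNReal.ofReal p) (P : Measure Ω)) P hP)
      ((le_iSup₂ (f := fun (P : ProbabilityMeasure Ω) (_ : P ∈ Ps) =>
        eLpNorm (X N - Y) (ENNReal.ofReal p) (P : Measure Ω)) P hP).trans (hN N le_rfl))
end

section
/- Let Ω be a complete separable metric space, 𝒫 a nonempty family of Borel probability measures on Ω, and p ∈ (0, ∞). Let (X_n) and X be Borel functions with sup_{P∈𝒫} E_P[|X_n|^p] < ∞ and sup_{P∈𝒫} E_P[|X|^p] < ∞, and suppose sup_{P∈𝒫} E_P[|X_n − X|^p] → 0. Then there exists a subsequence (X_{n_k}) and a Borel set N with c(N) = 0 such that X_{n_k}(ω) → X(ω) for every ω ∉ N. -/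
open MeasureTheory Filter Topology ENNReal

/-- If the upper expectations of `f k` are summable, then `∑ f k` is finite outside a polar set. -/
lemma iSup_measure_tsum_eq_top_eq_zero {Ω : Type*} [MeasurableSpace Ω]
    (Ps : Set (ProbabilityMeasure Ω)) {f : ℕ → Ω → ENNReal} (hf : ∀ k, Measurable (f k))
    (hsum : ∑' k, ⨆ P ∈ Ps, ∫⁻ ω, f k ω ∂(P : Measure Ω) ≠ ⊤) :
    ⨆ P ∈ Ps, (P : Measure Ω) {ω | ∑' k, f k ω = ⊤} = 0 := by
  simp only [ENNReal.iSup_eq_zero]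
  intro P hP
  refine measure_eq_top_of_lintegral_ne_top (Measurable.tsum hf).aemeasurable ?_
  rw [lintegral_tsum fun k => (hf k).aemeasurable]
  exact ne_top_of_le_ne_top hsum (ENNReal.tsum_le_tsum fun k =>
    le_iSup₂ (f := fun P (_ : P ∈ Ps) => ∫⁻ ω, f k ω ∂(P : Measure Ω)) P hP)

/-- Convergence to zero of `|u|ᵖ` in `ENNReal` forces convergence to zero of `u`. -/
lemma tendsto_zero_of_tendsto_ofReal_abs_rpow {ι : Type*} {l : Filter ι} {u : ι → ℝ} {p : ℝ}
    (hp : 0 < p) (h : Tendsto (fun i => ENNReal.ofReal (|u i| ^ p)) l (𝓝 0)) :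
    Tendsto u l (𝓝 0) := by
  have h_real : Tendsto (fun i => |u i| ^ p) l (𝓝 0) := by
    have := (ENNReal.tendsto_toReal ENNReal.zero_ne_top).comp h
    simpa [Function.comp_def, ENNReal.toReal_ofReal, Real.rpow_nonneg] using this
  have h_root := h_real.rpow_const (p := p⁻¹) (Or.inr (inv_nonneg.2 hp.le))
  rw [Real.zero_rpow (inv_ne_zero hp.ne')] at h_root
  simp only [Real.rpow_rpow_inv (abs_nonneg _) hp.ne'] at h_root
  exact (tendsto_zero_iff_abs_tendsto_zero _).2 h_root

/-- If `Xₙ → X` in `𝕃^p` (i.e. `sup_{P ∈ Ps} E_P[|Xₙ - X|^p] → 0`) for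
some `p ∈ (0, ∞)`, then some subsequence of `(Xₙ)` converges to `X` quasi-surely, i.e.
outside a polar set (a Borel set `N` with `c(N) = sup_{P ∈ Ps} P(N) = 0`). -/
theorem convergence_upperLp_implies_qs_subsequence
    {Ω : Type*} [MetricSpace Ω] [CompleteSpace Ω] [TopologicalSpace.SeparableSpace Ω]
    [MeasurableSpace Ω] [BorelSpace Ω]
    (Ps : Set (ProbabilityMeasure Ω)) (hPs : Ps.Nonempty)
    (p : ℝ) (hp : 0 < p)
    (X : ℕ → Ω → ℝ) (Y : Ω → ℝ)
    (hXmeas : ∀ n, Measurable (X n)) (hYmeas : Measurable Y)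
    (hXfin : ∀ n, (⨆ P ∈ Ps, ∫⁻ ω, ENNReal.ofReal (|X n ω| ^ p) ∂(P : Measure Ω)) < ⊤)
    (hYfin : (⨆ P ∈ Ps, ∫⁻ ω, ENNReal.ofReal (|Y ω| ^ p) ∂(P : Measure Ω)) < ⊤)
    (hconv : Tendsto
      (fun n => ⨆ P ∈ Ps, ∫⁻ ω, ENNReal.ofReal (|X n ω - Y ω| ^ p) ∂(P : Measure Ω))
      atTop (𝓝 0)) :
    ∃ φ : ℕ → ℕ, StrictMono φ ∧
      ∃ N : Set Ω, MeasurableSet N ∧ (⨆ P ∈ Ps, (P : Measure Ω) N) = 0 ∧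
        ∀ ω ∉ N, Tendsto (fun k => X (φ k) ω) atTop (𝓝 (Y ω)) := by
  obtain ⟨φ, hφ, hφ_lt⟩ := extraction_forall_of_eventually fun k =>
    hconv.eventually_lt_const (ENNReal.pow_pos (by simp : (0 : ENNReal) < 2⁻¹) k)
  have hmeas : ∀ k, Measurable fun ω => ENNReal.ofReal (|X (φ k) ω - Y ω| ^ p) := fun k => by
    have := hXmeas (φ k)
    fun_prop
  refine ⟨φ, hφ, {ω | ∑' k, ENNReal.ofReal (|X (φ k) ω - Y ω| ^ p) = ⊤},
    measurableSet_eq_fun (Measurable.tsum hmeas) measurable_const,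
    iSup_measure_tsum_eq_top_eq_zero Ps hmeas ?_, fun ω hω => ?_⟩
  · refine ne_top_of_le_ne_top ?_ (ENNReal.tsum_le_tsum fun k => (hφ_lt k).le)
    simp [ENNReal.tsum_geometric]
  · exact tendsto_sub_nhds_zero_iff.1 (tendsto_zero_of_tendsto_ofReal_abs_rpow hp
      (ENNReal.tendsto_atTop_zero_of_tsum_ne_top hω))
end

section
/- Let Ω be a complete separable metric space, 𝒫 a nonempty family of Borel probability measures on Ω, 𝔼[Y] := sup_{P∈𝒫} E_P[Y], and p > 0. For a Borel function X with 𝔼[|X|^p] < ∞, the following are equivalent: (i) there exists a sequence (Y_n) of bounded Borel functions with 𝔼[|X − Y_n|^p] → 0 (i.e. X belongs to 𝕃^p_b, the completion of B_b(Ω) in 𝕃^p); (ii) lim_{n→∞} 𝔼[|X|^p · 1_{{|X| > n}}] = 0. -/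
open MeasureTheory Filter Topology ENNReal

/-- Where `|x|` exceeds twice a bound for `y`, the power `|x| ^ p` is controlled by
`|x - y| ^ p`. -/
lemma ofReal_abs_rpow_le_of_two_mul_lt {p M x y : ℝ} (hp : 0 ≤ p) (hy : |y| ≤ M)
    (hx : 2 * M < |x|) :
    ENNReal.ofReal (|x| ^ p) ≤ ENNReal.ofReal (2 ^ p) * ENNReal.ofReal (|x - y| ^ p) := by
  rw [← ENNReal.ofReal_mul (by positivity), ← Real.mul_rpow (by norm_num) (abs_nonneg _)]
  apply ENNReal.ofReal_le_ofReal
  apply Real.rpow_le_rpow (abs_nonneg _) _ hp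
  linarith [abs_sub_abs_le_abs_sub x y]

lemma ofReal_abs_sub_indicator_rpow {Ω : Type*} {p : ℝ} (hp : 0 < p) (X : Ω → ℝ) (s : Set Ω)
    (ω : Ω) :
    ENNReal.ofReal (|X ω - sᶜ.indicator X ω| ^ p) =
      s.indicator (fun ω => ENNReal.ofReal (|X ω| ^ p)) ω := by
  by_cases h : ω ∈ s <;> simp [h, Real.zero_rpow hp.ne']

/-- Characterization of `𝕃^p_b`, the completion of the bounded Borel
functions under `𝔼[|·|^p]` (where `𝔼[Z] = sup_{P ∈ Ps} E_P[Z]`): a Borel function `X`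
with `𝔼[|X|^p] < ∞` is approximable by bounded Borel functions if and only if
`𝔼[|X|^p 1_{{|X| > n}}] → 0` as `n → ∞`. -/
theorem mem_Lp_b_iff_tail
    {Ω : Type*} [MetricSpace Ω] [CompleteSpace Ω] [TopologicalSpace.SeparableSpace Ω]
    [MeasurableSpace Ω] [BorelSpace Ω]
    (Ps : Set (ProbabilityMeasure Ω)) (hPs : Ps.Nonempty)
    (p : ℝ) (hp : 0 < p)
    (X : Ω → ℝ) (hX : Measurable X)
    (hXfin : (⨆ P ∈ Ps, ∫⁻ ω, ENNReal.ofReal (|X ω| ^ p) ∂(P : Measure Ω)) < ⊤) :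
    (∃ Y : ℕ → Ω → ℝ, (∀ n, Measurable (Y n)) ∧ (∀ n, ∃ M : ℝ, ∀ ω, |Y n ω| ≤ M) ∧
      Tendsto
        (fun n => ⨆ P ∈ Ps, ∫⁻ ω, ENNReal.ofReal (|X ω - Y n ω| ^ p) ∂(P : Measure Ω))
        atTop (𝓝 0)) ↔
    Tendsto
      (fun n : ℕ => ⨆ P ∈ Ps,
        ∫⁻ ω in {ω' | (n : ℝ) < |X ω'|}, ENNReal.ofReal (|X ω| ^ p) ∂(P : Measure Ω))
      atTop (𝓝 0) := by
  have hS (n : ℕ) : MeasurableSet {ω | (n : ℝ) < |X ω|} :=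
    measurableSet_lt measurable_const hX.abs
  constructor
  · rintro ⟨Y, -, hYb, hY⟩
    have hY' := ENNReal.Tendsto.const_mul (a := ENNReal.ofReal (2 ^ p)) hY
      (Or.inr ENNReal.ofReal_ne_top)
    rw [mul_zero] at hY'
    rw [ENNReal.tendsto_nhds_zero] at hY' ⊢
    intro ε hε
    obtain ⟨k, hk⟩ := (hY' ε hε).exists
    obtain ⟨M, hM⟩ := hYb k
    filter_upwards [eventually_ge_atTop ⌈2 * M⌉₊] with n hn
    refine le_trans (iSup₂_le fun P hP => ?_) hk
    calc ∫⁻ ω in {ω' | (n : ℝ) < |X ω'|}, ENNReal.ofReal (|X ω| ^ p) ∂(P : Measure Ω)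
        ≤ ∫⁻ ω in {ω' | (n : ℝ) < |X ω'|},
            ENNReal.ofReal (2 ^ p) * ENNReal.ofReal (|X ω - Y k ω| ^ p) ∂(P : Measure Ω) :=
          setLIntegral_mono' (hS n) fun ω hω =>
            ofReal_abs_rpow_le_of_two_mul_lt hp.le (hM ω)
              ((Nat.ceil_le.mp hn).trans_lt hω)
      _ ≤ ∫⁻ ω, ENNReal.ofReal (2 ^ p) * ENNReal.ofReal (|X ω - Y k ω| ^ p) ∂(P : Measure Ω) :=
          setLIntegral_le_lintegral _ _
      _ = ENNReal.ofReal (2 ^ p) * ∫⁻ ω, ENNReal.ofReal (|X ω - Y k ω| ^ p) ∂(P : Measure Ω) :=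
          lintegral_const_mul' _ _ ENNReal.ofReal_ne_top
      _ ≤ _ := by
          gcongr
          exact le_iSup₂ (f := fun (P : ProbabilityMeasure Ω) (_ : P ∈ Ps) =>
            ∫⁻ ω, ENNReal.ofReal (|X ω - Y k ω| ^ p) ∂(P : Measure Ω)) P hP
  · intro h
    refine ⟨fun n => {ω | (n : ℝ) < |X ω|}ᶜ.indicator X, fun n => hX.indicator (hS n).compl,
      fun n => ⟨n, fun ω => ?_⟩, ?_⟩
    · by_cases hω : (n : ℝ) < |X ω|
      · simp [Set.indicator, hω]
      · simpa [Set.indicator, hω] using not_lt.mp hω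
    · simpa only [ofReal_abs_sub_indicator_rpow hp, lintegral_indicator (hS _)] using h
end

section
/- Let Ω be a complete separable metric space, 𝒫 a nonempty family of Borel probability measures on Ω, 𝔼[Y] := sup_{P∈𝒫} E_P[Y], c(A) := sup_{P∈𝒫} P(A), and p > 0. If X is a Borel function such that there exists a sequence (X_n) of bounded continuous functions on Ω with 𝔼[|X − X_n|^p] → 0, then X has a quasi-continuous version: there exists Y: Ω → ℝ with X = Y quasi-surely and such that for every ε > 0 there is an open set O with c(O) < ε and Y restricted to Oᶜ continuous. -/
open MeasureTheory Filter Topology ENNReal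

/-- The capacity `c(A) = sup_{P ∈ Ps} P(A)` associated to a family of probability
measures `Ps`. -/
noncomputable def upperCapacity {Ω : Type*} [MeasurableSpace Ω]
    (Ps : Set (MeasureTheory.ProbabilityMeasure Ω)) (A : Set Ω) : ℝ≥0∞ :=
  ⨆ P ∈ Ps, (P : MeasureTheory.Measure Ω) A

/-- A function `Y : Ω → ℝ` is quasi-continuous (w.r.t. the capacity of the family `Ps`)
if for every `ε > 0` there is an open set `O` with `c(O) < ε` such that the restriction
of `Y` to `Oᶜ` is continuous. -/
def UpperQuasiContinuous {Ω : Type*} [TopologicalSpace Ω] [MeasurableSpace Ω]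
    (Ps : Set (MeasureTheory.ProbabilityMeasure Ω)) (Y : Ω → ℝ) : Prop :=
  ∀ ε : ℝ≥0∞, 0 < ε → ∃ O : Set Ω, IsOpen O ∧ upperCapacity Ps O < ε ∧
    Continuous fun x : (Oᶜ : Set Ω) => Y x

section Capacity

variable {Ω : Type*} [MeasurableSpace Ω] {Ps : Set (ProbabilityMeasure Ω)}

theorem upperCapacity_mono {A B : Set Ω} (h : A ⊆ B) :
    upperCapacity Ps A ≤ upperCapacity Ps B :=
  iSup₂_mono fun _ _ => measure_mono h

theorem upperCapacity_iUnion_le (A : ℕ → Set Ω) :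
    upperCapacity Ps (⋃ k, A k) ≤ ∑' k, upperCapacity Ps (A k) :=
  iSup₂_le fun P hP => (measure_iUnion_le A).trans <|
    ENNReal.tsum_le_tsum fun k =>
      le_iSup₂ (f := fun (P : ProbabilityMeasure Ω) (_ : P ∈ Ps) => (P : Measure Ω) (A k)) P hP

/-- Markov's inequality for the upper expectation. -/
theorem upperCapacity_le_abs_le {p a : ℝ} (hp : 0 < p) (ha : 0 < a)
    {Z : Ω → ℝ} (hZ : Measurable Z) :
    upperCapacity Ps {ω | a ≤ |Z ω|} ≤
      (⨆ P ∈ Ps, ∫⁻ ω, ENNReal.ofReal (|Z ω| ^ p) ∂(P : Measure Ω)) / ENNReal.ofReal (a ^ p) := by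
  have hap : 0 < a ^ p := Real.rpow_pos_of_pos ha p
  refine iSup₂_le fun P hP => ?_
  calc (P : Measure Ω) {ω | a ≤ |Z ω|}
      ≤ (P : Measure Ω) {ω | ENNReal.ofReal (a ^ p) ≤ ENNReal.ofReal (|Z ω| ^ p)} :=
        measure_mono fun ω hω =>
          ENNReal.ofReal_le_ofReal (Real.rpow_le_rpow ha.le hω hp.le)
    _ ≤ (∫⁻ ω, ENNReal.ofReal (|Z ω| ^ p) ∂(P : Measure Ω)) / ENNReal.ofReal (a ^ p) :=
        meas_ge_le_lintegral_div (by fun_prop) (by simpa using hap) ENNReal.ofReal_ne_top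
    _ ≤ _ := by
        gcongr
        exact le_iSup₂ (f := fun (P : ProbabilityMeasure Ω) (_ : P ∈ Ps) =>
          ∫⁻ ω, ENNReal.ofReal (|Z ω| ^ p) ∂(P : Measure Ω)) P hP

/-- Convergence of the upper `p`-th moments implies convergence in capacity. -/
theorem tendsto_upperCapacity_le_abs {p a : ℝ} (hp : 0 < p) (ha : 0 < a)
    {Z : ℕ → Ω → ℝ} (hZ : ∀ n, Measurable (Z n))
    (h : Tendsto (fun n => ⨆ P ∈ Ps, ∫⁻ ω, ENNReal.ofReal (|Z n ω| ^ p) ∂(P : Measure Ω))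
      atTop (𝓝 0)) :
    Tendsto (fun n => upperCapacity Ps {ω | a ≤ |Z n ω|}) atTop (𝓝 0) := by
  have hap : ENNReal.ofReal (a ^ p) ≠ 0 := by simpa using Real.rpow_pos_of_pos ha p
  have hdiv := ENNReal.Tendsto.div_const h (Or.inr hap)
  rw [ENNReal.zero_div] at hdiv
  exact tendsto_of_tendsto_of_tendsto_of_le_of_le tendsto_const_nhds hdiv
    (fun _ => zero_le) fun n => upperCapacity_le_abs_le hp ha (hZ n)

end Capacity

/-- A sequence of real functions whose consecutive differences are bounded by a geometric
sequence on `s` converges uniformly on `s`. -/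
theorem tendstoUniformlyOn_limUnder_of_abs_sub_le {α : Type*} {f : ℕ → α → ℝ} {s : Set α} {C : ℝ}
    (h : ∀ x ∈ s, ∀ k, |f k x - f (k + 1) x| ≤ C / 2 / 2 ^ k) :
    TendstoUniformlyOn f (fun x => limUnder atTop fun k => f k x) atTop s := by
  have hlim : ∀ x ∈ s, Tendsto (fun k => f k x) atTop (𝓝 (limUnder atTop fun k => f k x)) :=
    fun x hx => (cauchySeq_of_le_geometric_two (h x hx)).tendsto_limUnder
  have hC : Tendsto (fun k : ℕ => C / 2 ^ k) atTop (𝓝 0) :=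
    tendsto_const_nhds.div_atTop (tendsto_pow_atTop_atTop_of_one_lt one_lt_two)
  rw [Metric.tendstoUniformlyOn_iff]
  intro ε hε
  filter_upwards [hC.eventually (gt_mem_nhds hε)] with k hk x hx
  rw [dist_comm]
  exact (dist_le_of_le_geometric_two_of_tendsto (h x hx) (hlim x hx) k).trans_lt hk

/-- If a Borel function `X` is the limit, in `𝔼[|·|^p]` with
`𝔼[Z] = sup_{P ∈ Ps} E_P[Z]`, of a sequence of bounded continuous functions, then `X` has
a quasi-continuous version: a quasi-continuous `Y` with `X = Y` outside a polar set. -/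
theorem mem_Lp_c_has_qc_version
    {Ω : Type*} [MetricSpace Ω] [CompleteSpace Ω] [TopologicalSpace.SeparableSpace Ω]
    [MeasurableSpace Ω] [BorelSpace Ω]
    (Ps : Set (ProbabilityMeasure Ω)) (hPs : Ps.Nonempty)
    (p : ℝ) (hp : 0 < p)
    (X : Ω → ℝ) (hX : Measurable X)
    (Xn : ℕ → Ω → ℝ) (hXncont : ∀ n, Continuous (Xn n))
    (hXnbdd : ∀ n, ∃ M : ℝ, ∀ ω, |Xn n ω| ≤ M)
    (happrox : Tendsto
      (fun n => ⨆ P ∈ Ps, ∫⁻ ω, ENNReal.ofReal (|X ω - Xn n ω| ^ p) ∂(P : Measure Ω))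
      atTop (𝓝 0)) :
    ∃ Y : Ω → ℝ, UpperQuasiContinuous Ps Y ∧
      ∃ N : Set Ω, MeasurableSet N ∧ upperCapacity Ps N = 0 ∧ ∀ ω ∉ N, X ω = Y ω := by
  have hpow : ∀ k : ℕ, (0 : ℝ) < (1 / 2) ^ k := fun k => by positivity
  have hsub : ∀ k : ℕ, ∃ n, upperCapacity Ps {ω | (1 / 2 : ℝ) ^ k ≤ |X ω - Xn n ω|} <
      (2⁻¹ : ℝ≥0∞) ^ k := fun k =>
    ((tendsto_upperCapacity_le_abs hp (hpow k)
      (fun n => hX.sub (hXncont n).measurable) happrox).eventually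
        (gt_mem_nhds (ENNReal.pow_pos (by simp) k))).exists
  choose φ hφ using hsub
  set f : ℕ → Ω → ℝ := fun k => Xn (φ k)
  have hfc : ∀ k, Continuous (f k) := fun k => hXncont (φ k)
  set A : ℕ → Set Ω := fun k => {ω | (1 / 2 : ℝ) ^ k ≤ |X ω - f k ω|} with hA
  have hAmeas : ∀ k, MeasurableSet (A k) := fun k =>
    measurableSet_le measurable_const (hX.sub (hfc k).measurable).abs
  have hsum : ∑' k, upperCapacity Ps (A k) ≠ ∞ := by
    refine ne_top_of_le_ne_top ?_ (ENNReal.tsum_le_tsum fun k => (hφ k).le)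
    rw [ENNReal.tsum_geometric, ENNReal.one_sub_inv_two, inv_inv]
    exact ENNReal.ofNat_ne_top
  have htail : Tendsto (fun m => upperCapacity Ps (⋃ j, A (j + m))) atTop (𝓝 0) :=
    tendsto_of_tendsto_of_tendsto_of_le_of_le tendsto_const_nhds
      (ENNReal.tendsto_sum_nat_add _ hsum) (fun _ => zero_le)
      fun m => upperCapacity_iUnion_le fun j => A (j + m)
  refine ⟨fun ω => limUnder atTop fun k => f k ω, fun ε hε => ?_,
    ⋂ m, ⋃ j, A (j + m), MeasurableSet.iInter fun m => MeasurableSet.iUnion fun j => hAmeas _,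
    ?_, fun ω hω => ?_⟩
  · obtain ⟨m, hm⟩ := (htail.eventually (gt_mem_nhds hε)).exists
    refine ⟨⋃ j, {ω | 2 * (1 / 2 : ℝ) ^ (j + m) < |f (j + m) ω - f (j + 1 + m) ω|},
      isOpen_iUnion fun j => isOpen_lt continuous_const ((hfc _).sub (hfc _)).abs,
      (upperCapacity_mono ?_).trans_lt hm, ?_⟩
    · refine Set.iUnion_subset fun j ω hω => ?_
      by_contra hω'
      simp only [hA, Set.mem_iUnion, Set.mem_ofPred_eq, not_exists, not_le] at hω hω'
      have h0 := abs_lt.1 (hω' j)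
      have h1 := abs_lt.1 (hω' (j + 1))
      have hle : (1 / 2 : ℝ) ^ (j + 1 + m) ≤ (1 / 2) ^ (j + m) :=
        pow_le_pow_of_le_one (by norm_num) (by norm_num) (by omega)
      refine hω.not_ge (abs_le.2 ⟨?_, ?_⟩) <;> linarith
    · refine (continuousOn_iff_continuous_domRestrict
        (f := fun ω => limUnder atTop fun k => f k ω)).1 ?_
      have hshift : (fun ω => limUnder atTop fun k => f k ω) =
          fun ω => limUnder atTop fun k => f (k + m) ω := by
        funext ω
        simp only [limUnder]
        rw [← map_add_atTop_eq_nat m, Filter.map_map, map_add_atTop_eq_nat m]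
        rfl
      rw [hshift]
      refine (tendstoUniformlyOn_limUnder_of_abs_sub_le (f := fun k => f (k + m))
        (C := 4 * (1 / 2) ^ m) fun ω hω k => ?_).continuousOn
          (Frequently.of_forall fun k => (hfc _).continuousOn)
      simp only [Set.mem_compl_iff, Set.mem_iUnion, Set.mem_ofPred_eq, not_exists, not_lt] at hω
      refine (hω k).trans_eq ?_
      rw [pow_add, one_div_pow (2 : ℝ) k]
      ring
  · exact le_antisymm
      (ge_of_tendsto' htail fun m => upperCapacity_mono (Set.iInter_subset _ m)) zero_le
  · simp only [hA, Set.mem_iInter, Set.mem_iUnion, Set.mem_ofPred_eq, not_forall, not_exists,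
      not_le] at hω
    obtain ⟨m, hm⟩ := hω
    refine (Tendsto.limUnder_eq ?_).symm
    rw [tendsto_iff_dist_tendsto_zero]
    refine squeeze_zero' (.of_forall fun _ => dist_nonneg) ?_
      (tendsto_pow_atTop_nhds_zero_of_lt_one (r := (1 / 2 : ℝ)) (by norm_num) (by norm_num))
    filter_upwards [eventually_ge_atTop m] with k hk
    have := (hm (k - m)).le
    rwa [Nat.sub_add_cancel hk, ← Real.dist_eq, dist_comm] at this
end

section
/- Let Ω be a complete separable metric space, 𝒫 a nonempty family of Borel probability measures on Ω, 𝔼[Y] := sup_{P∈𝒫} E_P[Y], and p > 0. Assume X: Ω → ℝ has a quasi-continuous version and there exists a function f: ℝ⁺ → ℝ⁺ with lim_{t→∞} f(t)/t^p = ∞ and 𝔼[f(|X|)] < ∞. Then lim_{N→∞} 𝔼[|X|^p · 1_{{|X| > N}}] = 0 and hence X lies in 𝕃^p_c, the completion of C_b(Ω) under 𝔼[|·|^p]. -/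
open MeasureTheory Filter Topology ENNReal

/-- De la Vallée-Poussin's criterion, uniformly over a family of measures. -/
theorem tendsto_iSup_setLIntegral_rpow_tail {Ω : Type*} [MeasurableSpace Ω]
    (Ps : Set (ProbabilityMeasure Ω)) (p : ℝ) (X : Ω → ℝ) (hX : Measurable X)
    (f : ℝ → ℝ) (hfgrow : Tendsto (fun t : ℝ => f t / t ^ p) atTop atTop)
    (hffin : (⨆ P ∈ Ps, ∫⁻ ω, ENNReal.ofReal (f |X ω|) ∂(P : Measure Ω)) < ⊤) :
    Tendsto
      (fun n : ℕ => ⨆ P ∈ Ps,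
        ∫⁻ ω in {ω' | (n : ℝ) < |X ω'|}, ENNReal.ofReal (|X ω| ^ p) ∂(P : Measure Ω))
      atTop (𝓝 0) := by
  set C := ⨆ P ∈ Ps, ∫⁻ ω, ENNReal.ofReal (f |X ω|) ∂(P : Measure Ω) with hC
  rw [ENNReal.tendsto_nhds_zero]
  intro ε hε
  have hlim : Tendsto (fun k : ℕ => C / (k : ℝ≥0∞)) atTop (𝓝 0) := by
    simpa using ENNReal.Tendsto.const_div (a := C) ENNReal.tendsto_nat_nhds_top
      (Or.inr hffin.ne)
  obtain ⟨k, hkε, hk⟩ :=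
    ((ENNReal.tendsto_nhds_zero.1 hlim ε hε).and (eventually_gt_atTop 0)).exists
  obtain ⟨T, hT⟩ := eventually_atTop.1 (hfgrow.eventually_ge_atTop (k : ℝ))
  obtain ⟨m, hm⟩ := exists_nat_ge T
  filter_upwards [eventually_ge_atTop m] with n hn
  refine iSup₂_le fun P hP => le_trans ?_ hkε
  rw [ENNReal.le_div_iff_mul_le (by simp [hk.ne']) (by simp), mul_comm,
    ← lintegral_const_mul _ (by fun_prop)]
  calc ∫⁻ ω in {ω' | (n : ℝ) < |X ω'|}, (k : ℝ≥0∞) * ENNReal.ofReal (|X ω| ^ p) ∂(P : Measure Ω)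
      ≤ ∫⁻ ω in {ω' | (n : ℝ) < |X ω'|}, ENNReal.ofReal (f |X ω|) ∂(P : Measure Ω) := by
        refine setLIntegral_mono' (measurableSet_lt measurable_const hX.abs) fun ω hω => ?_
        have hω' : (n : ℝ) < |X ω| := hω
        have hpos : 0 < |X ω| := n.cast_nonneg.trans_lt hω'
        have hle := hT |X ω| ((hm.trans (Nat.cast_le.2 hn)).trans hω'.le)
        rw [← ENNReal.ofReal_natCast, ← ENNReal.ofReal_mul k.cast_nonneg]
        exact ENNReal.ofReal_le_ofReal ((le_div_iff₀ (Real.rpow_pos_of_pos hpos p)).1 hle)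
    _ ≤ ∫⁻ ω, ENNReal.ofReal (f |X ω|) ∂(P : Measure Ω) := setLIntegral_le_lintegral _ _
    _ ≤ C := le_iSup₂ (f := fun (P : ProbabilityMeasure Ω) (_ : P ∈ Ps) =>
        ∫⁻ ω, ENNReal.ofReal (f |X ω|) ∂(P : Measure Ω)) P hP

theorem abs_clamp_le {r : ℝ} (hr : 0 ≤ r) (x : ℝ) : |max (-r) (min r x)| ≤ r :=
  abs_le.2 ⟨le_max_left _ _, max_le (by linarith) (min_le_left _ _)⟩

theorem clamp_eq_self {r x : ℝ} (hx : |x| ≤ r) : max (-r) (min r x) = x := by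
  rw [min_eq_right (abs_le.1 hx).2, max_eq_right (abs_le.1 hx).1]

/-- A function with a quasi-continuous version is approximated by bounded continuous functions up
to its tail and an arbitrarily small error. -/
theorem exists_continuous_lintegral_rpow_sub_le {Ω : Type*} [MetricSpace Ω]
    [MeasurableSpace Ω] [BorelSpace Ω]
    (Ps : Set (ProbabilityMeasure Ω)) {p : ℝ} (hp : 0 < p) (X : Ω → ℝ) (hX : Measurable X)
    (hqc : ∃ Y : Ω → ℝ, UpperQuasiContinuous Ps Y ∧
      ∃ N : Set Ω, MeasurableSet N ∧ upperCapacity Ps N = 0 ∧ ∀ ω ∉ N, X ω = Y ω)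
    {r : ℝ} (hr : 0 ≤ r) {ε : ℝ≥0∞} (hε : 0 < ε) :
    ∃ Z : Ω → ℝ, Continuous Z ∧ (∀ ω, |Z ω| ≤ r) ∧
      ∀ P ∈ Ps, ∫⁻ ω, ENNReal.ofReal (|X ω - Z ω| ^ p) ∂(P : Measure Ω) ≤
        ENNReal.ofReal (2 ^ p) *
          ∫⁻ ω in {ω' | r < |X ω'|}, ENNReal.ofReal (|X ω| ^ p) ∂(P : Measure Ω) + ε := by
  obtain ⟨Y, hY, N, -, hN0, hXY⟩ := hqc
  set D := ENNReal.ofReal ((2 * r) ^ p) with hD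
  obtain ⟨O, hO, hcO, hcont⟩ := hY (ε / (D + 1)) (ENNReal.div_pos hε.ne' (by simp [hD]))
  obtain ⟨g, hg⟩ := ContinuousMap.exists_restrict_eq hO.isClosed_compl
    (⟨fun x : (Oᶜ : Set Ω) => Y x, hcont⟩ : C((Oᶜ : Set Ω), ℝ))
  have hgY : ∀ ω ∉ O, g ω = Y ω := fun ω hω => DFunLike.congr_fun hg ⟨ω, hω⟩
  refine ⟨fun ω => max (-r) (min r (g ω)), by fun_prop, fun ω => abs_clamp_le hr _, ?_⟩
  intro P hP
  have hS : MeasurableSet {ω' | r < |X ω'|} := measurableSet_lt measurable_const hX.abs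
  have hPN : (P : Measure Ω) N = 0 := le_antisymm
    (hN0 ▸ le_iSup₂ (f := fun (P : ProbabilityMeasure Ω) (_ : P ∈ Ps) =>
      (P : Measure Ω) N) P hP) bot_le
  have hPO : (P : Measure Ω) O ≤ ε / (D + 1) :=
    (le_iSup₂ (f := fun (P : ProbabilityMeasure Ω) (_ : P ∈ Ps) =>
      (P : Measure Ω) O) P hP).trans hcO.le
  have hae : ∀ᵐ ω ∂(P : Measure Ω), ω ∉ N := measure_eq_zero_iff_ae_notMem.1 hPN
  calc ∫⁻ ω, ENNReal.ofReal (|X ω - max (-r) (min r (g ω))| ^ p) ∂(P : Measure Ω)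
      ≤ ∫⁻ ω, ({ω' | r < |X ω'|}.indicator
            (fun ω => ENNReal.ofReal (2 ^ p) * ENNReal.ofReal (|X ω| ^ p)) ω +
          O.indicator (fun _ => D) ω) ∂(P : Measure Ω) := by
        refine lintegral_mono_ae ?_
        filter_upwards [hae] with ω hω
        have hZ := abs_clamp_le hr (g ω)
        have habs := abs_sub (X ω) (max (-r) (min r (g ω)))
        rcases lt_or_ge r |X ω| with h | h
        · refine le_trans ?_ le_self_add
          rw [Set.indicator_of_mem (show ω ∈ {ω' | r < |X ω'|} from h),
            ← ENNReal.ofReal_mul (by positivity),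
            ← Real.mul_rpow zero_le_two (abs_nonneg _)]
          exact ENNReal.ofReal_le_ofReal
            (Real.rpow_le_rpow (abs_nonneg _) (by linarith) hp.le)
        · refine le_trans ?_ le_add_self
          by_cases hωO : ω ∈ O
          · rw [Set.indicator_of_mem hωO]
            exact ENNReal.ofReal_le_ofReal
              (Real.rpow_le_rpow (abs_nonneg _) (by linarith) hp.le)
          · rw [hgY ω hωO, ← hXY ω hω, clamp_eq_self h, sub_self, abs_zero,
              Real.zero_rpow hp.ne', ENNReal.ofReal_zero]
            exact bot_le
    _ = ENNReal.ofReal (2 ^ p) *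
          ∫⁻ ω in {ω' | r < |X ω'|}, ENNReal.ofReal (|X ω| ^ p) ∂(P : Measure Ω) +
          D * (P : Measure Ω) O := by
        rw [lintegral_add_right _ (measurable_const.indicator hO.measurableSet),
          lintegral_indicator hS, lintegral_indicator_const hO.measurableSet,
          lintegral_const_mul _ (by fun_prop)]
    _ ≤ _ := by
        gcongr
        calc D * (P : Measure Ω) O ≤ (D + 1) * (ε / (D + 1)) := by
              gcongr
              exact le_self_add
          _ ≤ ε := ENNReal.mul_div_le

/-- Suppose `X` has a quasi-continuous version and there is
`f : ℝ⁺ → ℝ⁺` with `f(t)/t^p → ∞` and `𝔼[f(|X|)] < ∞`, where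
`𝔼[Z] = sup_{P ∈ Ps} E_P[Z]`. Then `𝔼[|X|^p 1_{{|X| > N}}] → 0`, and hence `X` lies in
`𝕃^p_c`, the completion of `C_b(Ω)` under `𝔼[|·|^p]`. -/
theorem uniform_integrability_criterion
    {Ω : Type*} [MetricSpace Ω] [CompleteSpace Ω] [TopologicalSpace.SeparableSpace Ω]
    [MeasurableSpace Ω] [BorelSpace Ω]
    (Ps : Set (ProbabilityMeasure Ω)) (hPs : Ps.Nonempty)
    (p : ℝ) (hp : 0 < p)
    (X : Ω → ℝ) (hX : Measurable X)
    (hqc : ∃ Y : Ω → ℝ, UpperQuasiContinuous Ps Y ∧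
      ∃ N : Set Ω, MeasurableSet N ∧ upperCapacity Ps N = 0 ∧ ∀ ω ∉ N, X ω = Y ω)
    (f : ℝ → ℝ) (hfpos : ∀ t : ℝ, 0 ≤ t → 0 ≤ f t)
    (hfgrow : Tendsto (fun t : ℝ => f t / t ^ p) atTop atTop)
    (hffin : (⨆ P ∈ Ps, ∫⁻ ω, ENNReal.ofReal (f |X ω|) ∂(P : Measure Ω)) < ⊤) :
    Tendsto
      (fun n : ℕ => ⨆ P ∈ Ps,
        ∫⁻ ω in {ω' | (n : ℝ) < |X ω'|}, ENNReal.ofReal (|X ω| ^ p) ∂(P : Measure Ω))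
      atTop (𝓝 0) ∧
    ∃ Xn : ℕ → Ω → ℝ, (∀ n, Continuous (Xn n)) ∧ (∀ n, ∃ M : ℝ, ∀ ω, |Xn n ω| ≤ M) ∧
      Tendsto
        (fun n => ⨆ P ∈ Ps, ∫⁻ ω, ENNReal.ofReal (|X ω - Xn n ω| ^ p) ∂(P : Measure Ω))
        atTop (𝓝 0) := by
  have htail := tendsto_iSup_setLIntegral_rpow_tail Ps p X hX f hfgrow hffin
  refine ⟨htail, ?_⟩
  choose Z hZc hZb hZ using fun n : ℕ =>
    exists_continuous_lintegral_rpow_sub_le Ps hp X hX hqc (r := n) n.cast_nonneg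
      (ε := (n : ℝ≥0∞)⁻¹) (by simp)
  refine ⟨Z, hZc, fun n => ⟨n, hZb n⟩, ?_⟩
  have hbound := (ENNReal.Tendsto.const_mul (a := ENNReal.ofReal (2 ^ p)) htail
    (Or.inr ENNReal.ofReal_ne_top)).add ENNReal.tendsto_inv_nat_nhds_zero
  rw [mul_zero, add_zero] at hbound
  refine tendsto_of_tendsto_of_tendsto_of_le_of_le tendsto_const_nhds hbound
    (fun _ => bot_le) fun n => iSup₂_le fun P hP => (hZ n P hP).trans ?_
  gcongr
  exact le_iSup₂ (f := fun (P : ProbabilityMeasure Ω) (_ : P ∈ Ps) =>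
    ∫⁻ ω in {ω' | (n : ℝ) < |X ω'|}, ENNReal.ofReal (|X ω| ^ p) ∂(P : Measure Ω)) P hP
end

section
/- Let Ω be a complete separable metric space and 𝒫 a nonempty family of Borel probability measures on Ω. Let (P_n) ⊂ 𝒫 converge weakly to P ∈ 𝒫. If X is a Borel function belonging to 𝕃^1_c (i.e. X has a quasi-continuous version, 𝔼[|X|] < ∞, and lim_{N→∞} 𝔼[|X|·1_{{|X|>N}}] = 0, where 𝔼[Y] := sup_{Q∈𝒫} E_Q[Y]), then E_{P_n}[X] → E_P[X]. -/
open MeasureTheory Filter Topology ENNReal BoundedContinuousFunction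

theorem measure_le_upperCapacity {Ω : Type*} [MeasurableSpace Ω]
    {Ps : Set (ProbabilityMeasure Ω)} {P : ProbabilityMeasure Ω} (hP : P ∈ Ps) (A : Set Ω) :
    (P : Measure Ω) A ≤ upperCapacity Ps A :=
  le_iSup₂ (f := fun (P : ProbabilityMeasure Ω) (_ : P ∈ Ps) => (P : Measure Ω) A) P hP

/-- A function continuous on a closed set, truncated at level `a`, extends from that set to a
bounded continuous function on the whole space. -/
theorem exists_boundedContinuous_eq_truncation {Ω : Type*} [TopologicalSpace Ω] [NormalSpace Ω]
    {F : Set Ω} (hF : IsClosed F) {Y : Ω → ℝ} (hY : Continuous fun x : F => Y x)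
    {a : ℝ} (ha : 0 ≤ a) :
    ∃ f : Ω →ᵇ ℝ, (∀ x, f x ∈ Set.Icc (-a) a) ∧ ∀ x ∈ F, f x = max (-a) (min a (Y x)) := by
  have hmem : ∀ x : F, max (-a) (min a (Y x)) ∈ Set.Icc (-a) a := fun x =>
    ⟨le_max_left _ _, max_le (by linarith) (min_le_left _ _)⟩
  let g : F →ᵇ ℝ := BoundedContinuousFunction.ofNormedAddCommGroup
    (fun x : F => max (-a) (min a (Y x)))
    (continuous_const.max (continuous_const.min hY)) a
    fun x => abs_le.2 ⟨(hmem x).1, (hmem x).2⟩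
  obtain ⟨f, hf, hfg⟩ := g.exists_extension_forall_mem_Icc_of_isClosedEmbedding hmem
    (by linarith) hF.isClosedEmbedding_subtypeVal
  exact ⟨f, hf, fun x hx => congrFun hfg ⟨x, hx⟩⟩

theorem abs_sub_truncation_le {a : ℝ} (ha : 0 ≤ a) (x : ℝ) :
    |x - max (-a) (min a x)| ≤ if a < |x| then |x| else 0 := by
  split_ifs with h
  · rcases le_total 0 x with hx | hx
    · rw [abs_of_nonneg hx] at h ⊢
      rw [min_eq_left h.le, max_eq_right (by linarith), abs_le]
      constructor <;> linarith
    · rw [abs_of_nonpos hx] at h ⊢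
      rw [min_eq_right (by linarith), max_eq_left (by linarith), abs_le]
      constructor <;> linarith
  · rw [not_lt, abs_le] at h
    rw [min_eq_right h.2, max_eq_right h.1]
    simp

/-- A quasi-continuous function with uniformly small tails is approximated by bounded continuous
functions, uniformly in mean over the family. -/
theorem exists_boundedContinuous_lintegral_sub_le
    {Ω : Type*} [TopologicalSpace Ω] [NormalSpace Ω] [MeasurableSpace Ω] [BorelSpace Ω]
    {Ps : Set (ProbabilityMeasure Ω)} {X : Ω → ℝ} (hX : Measurable X)
    (hqc : ∃ Y : Ω → ℝ, UpperQuasiContinuous Ps Y ∧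
      ∃ N : Set Ω, MeasurableSet N ∧ upperCapacity Ps N = 0 ∧ ∀ ω ∉ N, X ω = Y ω)
    (htail : Tendsto
      (fun n : ℕ => ⨆ P ∈ Ps,
        ∫⁻ ω in {ω' | (n : ℝ) < |X ω'|}, ENNReal.ofReal |X ω| ∂(P : Measure Ω))
      atTop (𝓝 0)) {δ : ℝ≥0∞} (hδ : 0 < δ) :
    ∃ f : Ω →ᵇ ℝ, ∀ P ∈ Ps, ∫⁻ ω, ENNReal.ofReal |X ω - f ω| ∂(P : Measure Ω) ≤ δ := by
  obtain ⟨Y, hY, N, -, hN, hXY⟩ := hqc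
  have hδ2 : 0 < δ / 2 := ENNReal.half_pos hδ.ne'
  obtain ⟨n, hn⟩ := (htail.eventually_lt_const hδ2).exists
  have ha : (0 : ℝ) ≤ n := n.cast_nonneg
  have hC : ENNReal.ofReal (2 * n) ≠ ⊤ := ENNReal.ofReal_ne_top
  obtain ⟨O, hO, hcO, hYO⟩ := hY (δ / 2 / (ENNReal.ofReal (2 * n) + 1))
    (ENNReal.div_pos hδ2.ne' (by finiteness))
  obtain ⟨f, hf, hfY⟩ := exists_boundedContinuous_eq_truncation hO.isClosed_compl hYO ha
  refine ⟨f, fun P hP => ?_⟩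
  have hT : MeasurableSet {ω | (n : ℝ) < |X ω|} := measurableSet_lt measurable_const hX.abs
  have hPN : ∀ᵐ ω ∂(P : Measure Ω), ω ∉ N :=
    measure_eq_zero_iff_ae_notMem.1 (le_antisymm (hN ▸ measure_le_upperCapacity hP N) zero_le)
  have hbound : ∀ᵐ ω ∂(P : Measure Ω), ENNReal.ofReal |X ω - f ω| ≤
      {ω | (n : ℝ) < |X ω|}.indicator (fun ω => ENNReal.ofReal |X ω|) ω +
        O.indicator (fun _ => ENNReal.ofReal (2 * n)) ω := by
    filter_upwards [hPN] with ω hω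
    have h1 : ENNReal.ofReal |X ω - max (-(n : ℝ)) (min n (X ω))| ≤
        {ω | (n : ℝ) < |X ω|}.indicator (fun ω => ENNReal.ofReal |X ω|) ω := by
      refine (ENNReal.ofReal_le_ofReal (abs_sub_truncation_le ha (X ω))).trans ?_
      by_cases h : (n : ℝ) < |X ω| <;> simp [h]
    by_cases hωO : ω ∈ O
    · have h2 : |max (-(n : ℝ)) (min n (X ω)) - f ω| ≤ 2 * n := by
        have := hf ω
        have h3 : max (-(n : ℝ)) (min n (X ω)) ≤ n := max_le (by linarith) (min_le_left _ _)
        have h4 := le_max_left (-(n : ℝ)) (min n (X ω))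
        rw [abs_le]
        constructor <;> linarith [this.1, this.2]
      rw [Set.indicator_of_mem hωO]
      refine (ENNReal.ofReal_le_ofReal (abs_sub_le _ (max (-(n : ℝ)) (min n (X ω))) _)).trans ?_
      exact ENNReal.ofReal_add_le.trans (add_le_add h1 (ENNReal.ofReal_le_ofReal h2))
    · rw [hfY ω hωO, ← hXY ω hω]
      exact h1.trans le_self_add
  calc ∫⁻ ω, ENNReal.ofReal |X ω - f ω| ∂(P : Measure Ω)
      ≤ ∫⁻ ω, {ω | (n : ℝ) < |X ω|}.indicator (fun ω => ENNReal.ofReal |X ω|) ω +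
        O.indicator (fun _ => ENNReal.ofReal (2 * n)) ω ∂(P : Measure Ω) := lintegral_mono_ae hbound
    _ = (∫⁻ ω in {ω | (n : ℝ) < |X ω|}, ENNReal.ofReal |X ω| ∂(P : Measure Ω)) +
        ENNReal.ofReal (2 * n) * (P : Measure Ω) O := by
      rw [lintegral_add_right _ (measurable_const.indicator hO.measurableSet),
        lintegral_indicator hT, lintegral_indicator_const hO.measurableSet]
    _ ≤ δ / 2 + δ / 2 := by
      refine add_le_add ?_ ?_
      · exact (le_iSup₂ (f := fun (P : ProbabilityMeasure Ω) (_ : P ∈ Ps) =>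
          ∫⁻ ω in {ω | (n : ℝ) < |X ω|}, ENNReal.ofReal |X ω| ∂(P : Measure Ω)) P hP).trans hn.le
      · calc ENNReal.ofReal (2 * n) * (P : Measure Ω) O
            ≤ (ENNReal.ofReal (2 * n) + 1) * (δ / 2 / (ENNReal.ofReal (2 * n) + 1)) :=
              mul_le_mul' le_self_add ((measure_le_upperCapacity hP O).trans hcO.le)
          _ ≤ δ / 2 := ENNReal.mul_div_le
    _ = δ := ENNReal.add_halves δ

/-- If `(Pₙ) ⊆ Ps` converges weakly to `P ∈ Ps` and `X ∈ 𝕃¹_c` (i.e.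
`X` is Borel with a quasi-continuous version, `𝔼[|X|] < ∞` and
`𝔼[|X| 1_{{|X| > N}}] → 0`, where `𝔼[Z] = sup_{Q ∈ Ps} E_Q[Z]`), then
`E_{Pₙ}[X] → E_P[X]`. -/
theorem weak_convergence_L1c
    {Ω : Type*} [MetricSpace Ω] [CompleteSpace Ω] [TopologicalSpace.SeparableSpace Ω]
    [MeasurableSpace Ω] [BorelSpace Ω]
    (Ps : Set (ProbabilityMeasure Ω)) (hPs : Ps.Nonempty)
    (Pn : ℕ → ProbabilityMeasure Ω) (Q : ProbabilityMeasure Ω)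
    (hPn : ∀ n, Pn n ∈ Ps) (hQ : Q ∈ Ps)
    (hweak : ∀ f : Ω →ᵇ ℝ, Tendsto (fun n => ∫ ω, f ω ∂(Pn n : Measure Ω)) atTop
      (𝓝 (∫ ω, f ω ∂(Q : Measure Ω))))
    (X : Ω → ℝ) (hX : Measurable X)
    (hqc : ∃ Y : Ω → ℝ, UpperQuasiContinuous Ps Y ∧
      ∃ N : Set Ω, MeasurableSet N ∧ upperCapacity Ps N = 0 ∧ ∀ ω ∉ N, X ω = Y ω)
    (hXfin : (⨆ P ∈ Ps, ∫⁻ ω, ENNReal.ofReal |X ω| ∂(P : Measure Ω)) < ⊤)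
    (htail : Tendsto
      (fun n : ℕ => ⨆ P ∈ Ps,
        ∫⁻ ω in {ω' | (n : ℝ) < |X ω'|}, ENNReal.ofReal |X ω| ∂(P : Measure Ω))
      atTop (𝓝 0)) :
    Tendsto (fun n => ∫ ω, X ω ∂(Pn n : Measure Ω)) atTop
      (𝓝 (∫ ω, X ω ∂(Q : Measure Ω))) := by
  have hXint : ∀ P ∈ Ps, Integrable X (P : Measure Ω) := fun P hP => by
    refine ⟨hX.aestronglyMeasurable, ?_⟩
    rw [hasFiniteIntegral_iff_norm]
    exact (le_iSup₂ (f := fun (P : ProbabilityMeasure Ω) (_ : P ∈ Ps) =>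
      ∫⁻ ω, ENNReal.ofReal |X ω| ∂(P : Measure Ω)) P hP).trans_lt hXfin
  rw [Metric.tendsto_atTop]
  intro ε hε
  obtain ⟨f, hf⟩ := exists_boundedContinuous_lintegral_sub_le hX hqc htail
    (ENNReal.ofReal_pos.2 (show 0 < ε / 3 by positivity))
  have happrox : ∀ P ∈ Ps,
      dist (∫ ω, X ω ∂(P : Measure Ω)) (∫ ω, f ω ∂(P : Measure Ω)) ≤ ε / 3 := fun P hP => by
    rw [dist_eq_norm, ← integral_sub (hXint P hP) (f.integrable _)]
    refine (norm_integral_le_lintegral_norm _).trans ?_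
    exact ENNReal.toReal_le_of_le_ofReal (by positivity) (hf P hP)
  obtain ⟨n₀, hn₀⟩ := Metric.tendsto_atTop.1 (hweak f) (ε / 3) (by positivity)
  refine ⟨n₀, fun n hn => ?_⟩
  have h1 := happrox (Pn n) (hPn n)
  have h2 := happrox Q hQ
  rw [dist_comm] at h2
  linarith [hn₀ n hn, dist_triangle4 (∫ ω, X ω ∂(Pn n : Measure Ω))
    (∫ ω, f ω ∂(Pn n : Measure Ω)) (∫ ω, f ω ∂(Q : Measure Ω)) (∫ ω, X ω ∂(Q : Measure Ω))]
end

section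
/- (Kolmogorov criterion under a family of probabilities) Let Ω be a complete separable metric space, 𝒫 a nonempty family of Borel probability measures on Ω, 𝔼[Y] := sup_{P∈𝒫} E_P[Y], and c the associated capacity. Let p > 0, d ∈ ℕ, and let (X_t)_{t∈[0,1]^d} be a process such that each X_t is Borel with 𝔼[|X_t|^p] < ∞, and suppose there exist constants C > 0 and ε > 0 such that 𝔼[|X_t − X_s|^p] ≤ C|t − s|^{d+ε} for all s, t ∈ [0,1]^d. Then X admits a quasi-modification X̃ (i.e. X̃_t = X_t quasi-surely for each t ∈ [0,1]^d) such that for every α ∈ [0, ε/p), 𝔼[ (sup_{s≠t} |X̃_t − X̃_s| / |t−s|^α)^p ] < ∞; consequently there is a Borel set N with c(N) = 0 such that for every ω ∉ N the map t ↦ X̃_t(ω) is Hölder continuous of order α for every α < ε/p. -/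
open MeasureTheory Filter Topology ENNReal

namespace Kolmogorov

variable {d : ℕ}

/-- The Euclidean distance on `Fin d → ℝ`. -/
noncomputable def euclDist (s t : Fin d → ℝ) : ℝ := Real.sqrt (∑ i, (t i - s i) ^ 2)

lemma euclDist_nonneg (s t : Fin d → ℝ) : 0 ≤ euclDist s t := Real.sqrt_nonneg _

lemma abs_sub_le_euclDist (s t : Fin d → ℝ) (i : Fin d) : |t i - s i| ≤ euclDist s t :=
  Real.abs_le_sqrt <|
    Finset.single_le_sum (f := fun j => (t j - s j) ^ 2) (fun _ _ => sq_nonneg _)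
      (Finset.mem_univ i)

lemma euclDist_pos {s t : Fin d → ℝ} (h : s ≠ t) : 0 < euclDist s t := by
  obtain ⟨i, hi⟩ := Function.ne_iff.mp h
  exact (abs_pos.mpr (sub_ne_zero.mpr (Ne.symm hi))).trans_le (abs_sub_le_euclDist s t i)

lemma euclDist_le {s t : Fin d → ℝ} {δ : ℝ} (hδ : 0 ≤ δ) (h : ∀ i, |t i - s i| ≤ δ) :
    euclDist s t ≤ Real.sqrt d * δ := by
  rw [← Real.sqrt_sq hδ, ← Real.sqrt_mul (Nat.cast_nonneg d)]
  refine Real.sqrt_le_sqrt ((Finset.sum_le_card_nsmul Finset.univ _ (δ ^ 2) ?_).trans ?_)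
  · intro i _
    exact sq_le_sq' (by linarith [neg_abs_le (t i - s i), h i]) ((le_abs_self _).trans (h i))
  · simp

/-- The point of the dyadic grid of mesh `2⁻ⁿ` with integer coordinates `k`. -/
noncomputable def gridPt (n : ℕ) (k : Fin d → ℕ) : Fin d → ℝ := fun i => (k i : ℝ) / 2 ^ n

/-- Coordinates of the largest grid point of mesh `2⁻ⁿ` below `t`. -/
noncomputable def gridFloor (n : ℕ) (t : Fin d → ℝ) : Fin d → ℕ := fun i => ⌊2 ^ n * t i⌋₊

/-- The neighbour of `k` in direction `e - 1`, clamped to the cube `{0, …, 2ⁿ}^d`. -/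
def neighbor (n : ℕ) (k : Fin d → Fin (2 ^ n + 1)) (e : Fin d → Fin 3) : Fin d → ℕ :=
  fun i => min (2 ^ n) ((k i : ℕ) + (e i : ℕ) - 1)

/-- The `p`-th powers of the increments of `x` between neighbouring grid points of mesh `2⁻ⁿ`,
summed over the pairs of neighbours and, with weight `2 ^ (n β p)`, over `n`. -/
noncomputable def incrementSum (p β : ℝ) (x : (Fin d → ℝ) → ℝ) : ℝ≥0∞ :=
  ∑' n : ℕ, ENNReal.ofReal (((2 : ℝ) ^ (n * β)) ^ p) *
    ∑ q : (Fin d → Fin (2 ^ n + 1)) × (Fin d → Fin 3),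
      ENNReal.ofReal
        (|x (gridPt n fun i => (q.1 i : ℕ)) - x (gridPt n (neighbor n q.1 q.2))| ^ p)

/-- The limit of `x` along the dyadic approximations of `t` from below. -/
noncomputable def dyadicLim (x : (Fin d → ℝ) → ℝ) (t : Fin d → ℝ) : ℝ :=
  limUnder atTop fun n : ℕ => x (gridPt n (gridFloor n t))

lemma gridPt_mem {n : ℕ} {k : Fin d → ℕ} (hk : ∀ i, k i ≤ 2 ^ n) (i : Fin d) :
    gridPt n k i ∈ Set.Icc (0 : ℝ) 1 := by
  refine ⟨by unfold gridPt; positivity, ?_⟩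
  rw [gridPt, div_le_one (by positivity)]
  exact_mod_cast hk i

lemma gridFloor_le {t : Fin d → ℝ} (ht : ∀ i, t i ∈ Set.Icc (0 : ℝ) 1) (n : ℕ) (i : Fin d) :
    gridFloor n t i ≤ 2 ^ n := by
  refine Nat.floor_le_of_le ?_
  push_cast
  exact mul_le_of_le_one_right (by positivity) (ht i).2

lemma abs_gridPt_sub_le {n : ℕ} {k l : Fin d → ℕ} {i : Fin d} (h₁ : k i ≤ l i + 1)
    (h₂ : l i ≤ k i + 1) : |gridPt n l i - gridPt n k i| ≤ 1 / 2 ^ n := by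
  have h₁' : (k i : ℝ) ≤ l i + 1 := by exact_mod_cast h₁
  have h₂' : (l i : ℝ) ≤ k i + 1 := by exact_mod_cast h₂
  rw [gridPt, gridPt, ← sub_div, abs_div, abs_of_pos (by positivity : (0 : ℝ) < 2 ^ n)]
  gcongr
  exact abs_le.mpr ⟨by linarith, by linarith⟩

lemma abs_sub_gridPt_gridFloor_le {t : Fin d → ℝ} (ht : ∀ i, t i ∈ Set.Icc (0 : ℝ) 1) (n : ℕ)
    (i : Fin d) : |gridPt n (gridFloor n t) i - t i| ≤ 1 / 2 ^ n := by
  have h2 : (0 : ℝ) < 2 ^ n := by positivity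
  have h₁ := Nat.floor_le (mul_nonneg h2.le (ht i).1)
  have h₂ := (Nat.lt_floor_add_one (2 ^ n * t i)).le
  have : gridPt n (gridFloor n t) i - t i = ((⌊2 ^ n * t i⌋₊ : ℝ) - 2 ^ n * t i) / 2 ^ n := by
    simp only [gridPt, gridFloor]
    field_simp
  rw [this, abs_div, abs_of_pos h2]
  gcongr
  exact abs_le.mpr ⟨by linarith, by linarith⟩

lemma gridFloor_le_add_one {s t : Fin d → ℝ} (ht : ∀ i, t i ∈ Set.Icc (0 : ℝ) 1) {n : ℕ}
    {i : Fin d} (h : |t i - s i| ≤ 1 / 2 ^ n) : gridFloor n t i ≤ gridFloor n s i + 1 := by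
  have h2 : (0 : ℝ) < 2 ^ n := by positivity
  have h₁ := Nat.floor_le (mul_nonneg h2.le (ht i).1)
  have h₂ := Nat.lt_floor_add_one (2 ^ n * s i)
  have h₃ : 2 ^ n * t i ≤ 2 ^ n * s i + 1 := by
    have := (le_abs_self _).trans h
    rw [le_div_iff₀ h2] at this
    linarith
  have : (⌊2 ^ n * t i⌋₊ : ℝ) < (⌊2 ^ n * s i⌋₊ + 1 : ℕ) + 1 := by
    push_cast
    linarith
  exact Nat.lt_add_one_iff.mp (Nat.cast_lt.mp (this.trans_eq (Nat.cast_succ _).symm))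

lemma gridFloor_succ {t : Fin d → ℝ} (ht : ∀ i, t i ∈ Set.Icc (0 : ℝ) 1) (n : ℕ) (i : Fin d) :
    2 * gridFloor n t i ≤ gridFloor (n + 1) t i ∧
      gridFloor (n + 1) t i ≤ 2 * gridFloor n t i + 1 := by
  have h0 : 0 ≤ 2 ^ n * t i := mul_nonneg (by positivity) (ht i).1
  have h₁ := Nat.floor_le h0
  have h₂ := Nat.lt_floor_add_one (2 ^ n * t i)
  have e : (2 : ℝ) ^ (n + 1) * t i = 2 * (2 ^ n * t i) := by ring
  simp only [gridFloor, e]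
  constructor
  · refine Nat.le_floor ?_
    push_cast
    linarith
  · refine Nat.lt_add_one_iff.mp ((Nat.floor_lt (by positivity)).mpr ?_)
    push_cast
    linarith

lemma gridPt_eq_succ (n : ℕ) (k : Fin d → ℕ) : gridPt n k = gridPt (n + 1) fun i => 2 * k i := by
  ext i
  simp only [gridPt, pow_succ]
  push_cast
  field_simp

/-- Increments over neighbouring grid points are controlled by `incrementSum`. -/
lemma abs_sub_le_of_neighbor {p β : ℝ} (hp : 0 < p) {x : (Fin d → ℝ) → ℝ}
    (hS : incrementSum p β x ≠ ⊤) {n : ℕ} {k l : Fin d → ℕ} (hk : ∀ i, k i ≤ 2 ^ n)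
    (hl : ∀ i, l i ≤ 2 ^ n) (hkl : ∀ i, k i ≤ l i + 1) (hlk : ∀ i, l i ≤ k i + 1) :
    |x (gridPt n k) - x (gridPt n l)| ≤
      (incrementSum p β x).toReal ^ p⁻¹ * ((2 : ℝ) ^ (-β)) ^ n := by
  set S := incrementSum p β x with hSdef
  let q : (Fin d → Fin (2 ^ n + 1)) × (Fin d → Fin 3) :=
    (fun i => ⟨k i, Nat.lt_add_one_iff.mpr (hk i)⟩,
      fun i => ⟨l i + 1 - k i, by have := hlk i; omega⟩)
  have hq : neighbor n q.1 q.2 = l := by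
    ext i
    have := hl i
    have := hkl i
    simp only [neighbor, q]
    omega
  have hterm : ENNReal.ofReal (((2 : ℝ) ^ (n * β)) ^ p) *
      ENNReal.ofReal (|x (gridPt n k) - x (gridPt n l)| ^ p) ≤ S := by
    refine le_trans ?_ (ENNReal.le_tsum n)
    gcongr
    refine le_trans ?_ (Finset.single_le_sum (fun _ _ => zero_le) (Finset.mem_univ q))
    rw [hq]
  rw [← ENNReal.ofReal_mul (by positivity), ← Real.mul_rpow (by positivity) (abs_nonneg _),
    ENNReal.ofReal_le_iff_le_toReal hS] at hterm
  have h2 : (0 : ℝ) < 2 ^ (n * β) := by positivity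
  have := (Real.le_rpow_inv_iff_of_pos (by positivity) ENNReal.toReal_nonneg hp).mpr hterm
  rw [← Real.rpow_natCast, ← Real.rpow_mul (by norm_num), neg_mul, mul_comm β,
    Real.rpow_neg (by norm_num), ← div_eq_mul_inv, le_div_iff₀ h2, mul_comm]
  exact this

/-- The Hölder constant produced by chaining, up to the factor depending on the path. -/
noncomputable def chainConst (β : ℝ) : ℝ :=
  (1 + 2 * ((2 : ℝ) ^ (-β) / (1 - (2 : ℝ) ^ (-β)))) * 2 ^ β

lemma two_rpow_neg_lt_one {β : ℝ} (hβ : 0 < β) : (2 : ℝ) ^ (-β) < 1 :=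
  Real.rpow_lt_one_of_one_lt_of_neg (by norm_num) (by linarith)

lemma chainConst_pos {β : ℝ} (hβ : 0 < β) : 0 < chainConst β := by
  have := sub_pos.mpr (two_rpow_neg_lt_one hβ)
  unfold chainConst
  positivity

lemma exists_mesh {s t : Fin d → ℝ} (hs : ∀ i, s i ∈ Set.Icc (0 : ℝ) 1)
    (ht : ∀ i, t i ∈ Set.Icc (0 : ℝ) 1) (hst : s ≠ t) :
    ∃ n : ℕ, (∀ i, |t i - s i| ≤ 1 / 2 ^ n) ∧ (1 : ℝ) / 2 ^ n ≤ 2 * euclDist s t := by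
  have hr := euclDist_pos hst
  rcases le_or_gt (euclDist s t) 1 with h | h
  · obtain ⟨n, h₁, h₂⟩ := exists_nat_pow_near_of_lt_one hr h (by norm_num : (0 : ℝ) < 1 / 2)
      (by norm_num)
    rw [one_div_pow] at h₂
    rw [pow_succ, one_div_pow] at h₁
    exact ⟨n, fun i => (abs_sub_le_euclDist s t i).trans h₂, by linarith⟩
  · refine ⟨0, fun i => ?_, ?_⟩
    · rw [abs_le]
      constructor <;> simp <;> linarith [(hs i).1, (hs i).2, (ht i).1, (ht i).2]
    · simp
      linarith

/-- Chaining: the limit of `x` along the dyadic approximations is Hölder continuous on the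
unit cube as soon as `incrementSum p β x` is finite. -/
lemma abs_dyadicLim_sub_le {p β : ℝ} (hp : 0 < p) (hβ : 0 < β) {x : (Fin d → ℝ) → ℝ}
    (hS : incrementSum p β x ≠ ⊤) {s t : Fin d → ℝ} (hs : ∀ i, s i ∈ Set.Icc (0 : ℝ) 1)
    (ht : ∀ i, t i ∈ Set.Icc (0 : ℝ) 1) (hst : s ≠ t) :
    |dyadicLim x t - dyadicLim x s| ≤
      chainConst β * (incrementSum p β x).toReal ^ p⁻¹ * euclDist s t ^ β := by
  set A := (incrementSum p β x).toReal ^ p⁻¹ with hA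
  have hA0 : 0 ≤ A := by positivity
  set ρ : ℝ := 2 ^ (-β) with hρ
  have hρ0 : 0 < ρ := by positivity
  have hρ1 : ρ < 1 := two_rpow_neg_lt_one hβ
  have step : ∀ u : Fin d → ℝ, (∀ i, u i ∈ Set.Icc (0 : ℝ) 1) → ∀ n : ℕ,
      dist (x (gridPt n (gridFloor n u))) (x (gridPt (n + 1) (gridFloor (n + 1) u))) ≤
        (A * ρ) * ρ ^ n := by
    intro u hu n
    rw [gridPt_eq_succ n, Real.dist_eq, mul_assoc, ← pow_succ']
    refine abs_sub_le_of_neighbor hp hS (fun i => ?_) (gridFloor_le hu _)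
      (fun i => (gridFloor_succ hu n i).1.trans (Nat.le_succ _))
      (fun i => (gridFloor_succ hu n i).2)
    have := gridFloor_le hu n i
    rw [pow_succ]
    omega
  have near : ∀ u : Fin d → ℝ, (∀ i, u i ∈ Set.Icc (0 : ℝ) 1) → ∀ n : ℕ,
      dist (x (gridPt n (gridFloor n u))) (dyadicLim x u) ≤ A * ρ * ρ ^ n / (1 - ρ) := fun u hu =>
    dist_le_of_le_geometric_of_tendsto ρ (A * ρ) hρ1 (step u hu)
      (cauchySeq_of_le_geometric ρ (A * ρ) hρ1 (step u hu)).tendsto_limUnder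
  obtain ⟨n, hn, hn'⟩ := exists_mesh hs ht hst
  have mid : dist (x (gridPt n (gridFloor n t))) (x (gridPt n (gridFloor n s))) ≤ A * ρ ^ n :=
    abs_sub_le_of_neighbor hp hS (gridFloor_le ht n) (gridFloor_le hs n)
      (fun i => gridFloor_le_add_one ht (hn i))
      (fun i => gridFloor_le_add_one hs (by rw [abs_sub_comm]; exact hn i))
  have hpow : ρ ^ n ≤ 2 ^ β * euclDist s t ^ β := by
    have h := Real.rpow_le_rpow (by positivity) hn' hβ.le
    rw [Real.mul_rpow (by norm_num) (euclDist_nonneg s t)] at h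
    refine le_of_eq_of_le ?_ h
    rw [hρ, ← Real.rpow_natCast, ← Real.rpow_natCast, one_div, ← Real.rpow_neg (by norm_num),
      ← Real.rpow_mul (by norm_num), ← Real.rpow_mul (by norm_num)]
    ring_nf
  have h1ρ : 0 < 1 - ρ := sub_pos.mpr hρ1
  calc |dyadicLim x t - dyadicLim x s|
      ≤ A * ρ * ρ ^ n / (1 - ρ) + A * ρ ^ n + A * ρ * ρ ^ n / (1 - ρ) := by
        rw [← Real.dist_eq]
        refine (dist_triangle4 _ (x (gridPt n (gridFloor n t))) (x (gridPt n (gridFloor n s)))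
          _).trans (add_le_add (add_le_add ?_ mid) (near s hs n))
        rw [dist_comm]
        exact near t ht n
    _ = (1 + 2 * (ρ / (1 - ρ))) * A * ρ ^ n := by ring
    _ ≤ (1 + 2 * (ρ / (1 - ρ))) * A * (2 ^ β * euclDist s t ^ β) := by gcongr
    _ = chainConst β * A * euclDist s t ^ β := by rw [chainConst]; ring

lemma rpow_le_mul_rpow {s t : Fin d → ℝ} (hs : ∀ i, s i ∈ Set.Icc (0 : ℝ) 1)
    (ht : ∀ i, t i ∈ Set.Icc (0 : ℝ) 1) (hst : s ≠ t) {α β : ℝ} (hαβ : α ≤ β) :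
    euclDist s t ^ β ≤ (Real.sqrt d + 1) ^ (β - α) * euclDist s t ^ α := by
  have hr := euclDist_pos hst
  have hR : euclDist s t ≤ Real.sqrt d + 1 := by
    refine (euclDist_le zero_le_one fun i => ?_).trans (by linarith)
    rw [abs_le]
    constructor <;> linarith [(hs i).1, (hs i).2, (ht i).1, (ht i).2]
  have : euclDist s t ^ β = euclDist s t ^ (β - α) * euclDist s t ^ α := by
    rw [← Real.rpow_add hr, sub_add_cancel]
  rw [this]
  gcongr

/-- Hölder bound for the limit of `x` along dyadics, for any order `α ≤ β`. -/
lemma abs_dyadicLim_sub_le' {p α β : ℝ} (hp : 0 < p) (hβ : 0 < β) (hαβ : α ≤ β)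
    {x : (Fin d → ℝ) → ℝ} (hS : incrementSum p β x ≠ ⊤) {s t : Fin d → ℝ}
    (hs : ∀ i, s i ∈ Set.Icc (0 : ℝ) 1) (ht : ∀ i, t i ∈ Set.Icc (0 : ℝ) 1) (hst : s ≠ t) :
    |dyadicLim x t - dyadicLim x s| ≤
      chainConst β * (Real.sqrt d + 1) ^ (β - α) * (incrementSum p β x).toReal ^ p⁻¹ *
        euclDist s t ^ α := by
  have := chainConst_pos hβ
  calc _ ≤ chainConst β * (incrementSum p β x).toReal ^ p⁻¹ * euclDist s t ^ β :=
        abs_dyadicLim_sub_le hp hβ hS hs ht hst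
    _ ≤ chainConst β * (incrementSum p β x).toReal ^ p⁻¹ *
        ((Real.sqrt d + 1) ^ (β - α) * euclDist s t ^ α) := by
        gcongr
        exact rpow_le_mul_rpow hs ht hst hαβ
    _ = _ := by ring

/-- The `p`-th power of the `α`-Hölder ratios is controlled by `incrementSum`. -/
lemma ofReal_ratio_le {p α β : ℝ} (hp : 0 < p) (hβ : 0 < β) (hαβ : α ≤ β)
    (x : (Fin d → ℝ) → ℝ) {s t : Fin d → ℝ}
    (hs : ∀ i, s i ∈ Set.Icc (0 : ℝ) 1) (ht : ∀ i, t i ∈ Set.Icc (0 : ℝ) 1) (hst : s ≠ t) :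
    ENNReal.ofReal ((|dyadicLim x t - dyadicLim x s| / euclDist s t ^ α) ^ p) ≤
      ENNReal.ofReal ((chainConst β * (Real.sqrt d + 1) ^ (β - α)) ^ p) *
        incrementSum p β x := by
  have hc := chainConst_pos hβ
  by_cases hS : incrementSum p β x = ⊤
  · rw [hS, ENNReal.mul_top (by rw [ne_eq, ENNReal.ofReal_eq_zero, not_le]; positivity)]
    exact le_top
  have hr := euclDist_pos hst
  rw [← ENNReal.ofReal_toReal hS, ← ENNReal.ofReal_mul (by positivity)]
  refine ENNReal.ofReal_le_ofReal ?_
  calc (|dyadicLim x t - dyadicLim x s| / euclDist s t ^ α) ^ p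
      ≤ (chainConst β * (Real.sqrt d + 1) ^ (β - α) *
          (incrementSum p β x).toReal ^ p⁻¹) ^ p := by
        refine Real.rpow_le_rpow (by positivity) ?_ hp.le
        rw [div_le_iff₀ (by positivity)]
        exact abs_dyadicLim_sub_le' hp hβ hαβ hS hs ht hst
    _ = _ := by
        rw [Real.mul_rpow (by positivity) (by positivity),
          Real.rpow_inv_rpow ENNReal.toReal_nonneg hp.ne']

/-- The set where the dyadic approximations of `X t` may fail to converge to `X t`. -/
def badSet {Ω : Type*} (X : (Fin d → ℝ) → Ω → ℝ) (p : ℝ) (t : Fin d → ℝ) : Set Ω :=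
  {ω | ∑' n : ℕ, ENNReal.ofReal (|X (gridPt n (gridFloor n t)) ω - X t ω| ^ p) = ⊤}

lemma eq_dyadicLim_of_notMem_badSet {Ω : Type*} {X : (Fin d → ℝ) → Ω → ℝ} {p : ℝ}
    (hp : 0 < p) {t : Fin d → ℝ} {ω : Ω} (hω : ω ∉ badSet X p t) : X t ω = dyadicLim (fun s => X s ω) t := by
  have h₁ := ENNReal.tendsto_atTop_zero_of_tsum_ne_top hω
  have h₂ : Tendsto (fun n : ℕ => |X (gridPt n (gridFloor n t)) ω - X t ω| ^ p) atTop (𝓝 0) := by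
    have := (ENNReal.tendsto_toReal ENNReal.zero_ne_top).comp h₁
    refine this.congr fun n => ?_
    simp only [Function.comp_apply]
    exact ENNReal.toReal_ofReal (by positivity)
  have h₃ := h₂.rpow_const (p := p⁻¹) (Or.inr (by positivity))
  rw [Real.zero_rpow (by positivity)] at h₃
  have h₄ : Tendsto (fun n : ℕ => X (gridPt n (gridFloor n t)) ω) atTop (𝓝 (X t ω)) := by
    rw [tendsto_iff_dist_tendsto_zero]
    refine h₃.congr fun n => ?_
    rw [Real.rpow_rpow_inv (abs_nonneg _) hp.ne', Real.dist_eq]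
  exact h₄.limUnder_eq.symm

section Measure

variable {Ω : Type*} [MeasurableSpace Ω] {X : (Fin d → ℝ) → Ω → ℝ} {p C ε : ℝ}

lemma measurable_increment (hX : ∀ t, Measurable (X t)) (s t : Fin d → ℝ) :
    Measurable fun ω => ENNReal.ofReal (|X s ω - X t ω| ^ p) :=
  ((((hX s).sub (hX t)).abs).pow_const p).ennreal_ofReal

lemma measurable_incrementSum (hX : ∀ t, Measurable (X t)) (β : ℝ) :
    Measurable fun ω => incrementSum p β fun t => X t ω := by
  unfold incrementSum
  exact Measurable.tsum fun n =>
    (Finset.measurable_sum _ fun q _ => measurable_increment hX _ _).const_mul _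

/-- The bound on the expectation of `incrementSum` under the Kolmogorov condition. -/
noncomputable def incrementBound (d : ℕ) (p C ε β : ℝ) : ℝ≥0∞ :=
  ∑' n : ℕ, ENNReal.ofReal
    (6 ^ d * C * Real.sqrt d ^ ((d : ℝ) + ε) * ((2 : ℝ) ^ (β * p - ε)) ^ n)

lemma incrementBound_lt_top {β : ℝ} (hp : 0 < p) (hC : 0 < C) (hβ : β < ε / p) :
    incrementBound d p C ε β < ⊤ := by
  have hlt : (2 : ℝ) ^ (β * p - ε) < 1 :=
    Real.rpow_lt_one_of_one_lt_of_neg (by norm_num) (by linarith [(lt_div_iff₀ hp).mp hβ])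
  have hsum := (summable_geometric_of_lt_one (by positivity) hlt).mul_left
    (6 ^ d * C * Real.sqrt d ^ ((d : ℝ) + ε))
  rw [incrementBound, ← ENNReal.ofReal_tsum_of_nonneg (fun n => by positivity) hsum]
  exact ENNReal.ofReal_lt_top

lemma lintegral_increment_le (hC : 0 < C) (hε : 0 < ε) {P : Measure Ω}
    (hkol : ∀ s t : Fin d → ℝ, (∀ i, s i ∈ Set.Icc (0 : ℝ) 1) →
      (∀ i, t i ∈ Set.Icc (0 : ℝ) 1) →
      ∫⁻ ω, ENNReal.ofReal (|X t ω - X s ω| ^ p) ∂P ≤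
        ENNReal.ofReal (C * euclDist s t ^ ((d : ℝ) + ε)))
    {s t : Fin d → ℝ} (hs : ∀ i, s i ∈ Set.Icc (0 : ℝ) 1) (ht : ∀ i, t i ∈ Set.Icc (0 : ℝ) 1)
    {n : ℕ} (h : ∀ i, |t i - s i| ≤ 1 / 2 ^ n) :
    ∫⁻ ω, ENNReal.ofReal (|X t ω - X s ω| ^ p) ∂P ≤
      ENNReal.ofReal (C * Real.sqrt d ^ ((d : ℝ) + ε) * ((2 : ℝ) ^ (-((d : ℝ) + ε))) ^ n) := by
  refine (hkol s t hs ht).trans (ENNReal.ofReal_le_ofReal ?_)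
  have hle := Real.rpow_le_rpow (euclDist_nonneg s t) (euclDist_le (by positivity) h)
    (by positivity : 0 ≤ (d : ℝ) + ε)
  have e : ((1 : ℝ) / 2 ^ n) ^ ((d : ℝ) + ε) = ((2 : ℝ) ^ (-((d : ℝ) + ε))) ^ n := by
    rw [← Real.rpow_natCast, ← Real.rpow_natCast, one_div, ← Real.rpow_neg (by norm_num),
      ← Real.rpow_mul (by norm_num), ← Real.rpow_mul (by norm_num)]
    ring_nf
  rw [Real.mul_rpow (by positivity) (by positivity), e] at hle
  rw [mul_assoc]
  gcongr

lemma lintegral_incrementSum_le (hX : ∀ t, Measurable (X t)) (hC : 0 < C) (hε : 0 < ε)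
    {P : Measure Ω}
    (hkol : ∀ s t : Fin d → ℝ, (∀ i, s i ∈ Set.Icc (0 : ℝ) 1) →
      (∀ i, t i ∈ Set.Icc (0 : ℝ) 1) →
      ∫⁻ ω, ENNReal.ofReal (|X t ω - X s ω| ^ p) ∂P ≤
        ENNReal.ofReal (C * euclDist s t ^ ((d : ℝ) + ε))) (β : ℝ) :
    ∫⁻ ω, incrementSum p β (fun t => X t ω) ∂P ≤ incrementBound d p C ε β := by
  have hm := measurable_increment (p := p) hX
  unfold incrementSum incrementBound
  rw [lintegral_tsum fun n =>
    ((Finset.measurable_sum _ fun q _ => hm _ _).const_mul _).aemeasurable]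
  refine ENNReal.tsum_le_tsum fun n => ?_
  rw [lintegral_const_mul _ (Finset.measurable_sum _ fun q _ => hm _ _),
    lintegral_finsetSum _ fun q _ => hm _ _]
  set B : ℝ := C * Real.sqrt d ^ ((d : ℝ) + ε) * ((2 : ℝ) ^ (-((d : ℝ) + ε))) ^ n with hB
  have hB0 : 0 ≤ B := by positivity
  have hpair : ∀ q : (Fin d → Fin (2 ^ n + 1)) × (Fin d → Fin 3),
      ∫⁻ ω, ENNReal.ofReal (|X (gridPt n fun i => (q.1 i : ℕ)) ω -
        X (gridPt n (neighbor n q.1 q.2)) ω| ^ p) ∂P ≤ ENNReal.ofReal B := by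
    intro q
    have hk : ∀ i, (q.1 i : ℕ) ≤ 2 ^ n := fun i => Nat.lt_add_one_iff.mp (q.1 i).2
    have hl : ∀ i, neighbor n q.1 q.2 i ≤ 2 ^ n := fun i => min_le_left _ _
    refine lintegral_increment_le hC hε hkol (gridPt_mem hl) (gridPt_mem hk) fun i => ?_
    have := hk i
    have := (q.2 i).2
    refine abs_gridPt_sub_le ?_ ?_ <;> simp only [neighbor] <;> omega
  have hcard : ((2 : ℝ) ^ n + 1) ^ d * 3 ^ d ≤ 6 ^ d * ((2 : ℝ) ^ n) ^ d := by
    rw [← mul_pow, ← mul_pow]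
    have : (1 : ℝ) ≤ 2 ^ n := one_le_pow₀ (by norm_num)
    exact pow_le_pow_left₀ (by positivity) (by linarith) d
  calc _ ≤ ENNReal.ofReal (((2 : ℝ) ^ (n * β)) ^ p) *
        ∑ _q : (Fin d → Fin (2 ^ n + 1)) × (Fin d → Fin 3), ENNReal.ofReal B := by
        gcongr with q
        exact hpair q
    _ = ENNReal.ofReal (((2 : ℝ) ^ (n * β)) ^ p * ((((2 : ℝ) ^ n + 1) ^ d * 3 ^ d) * B)) := by
        rw [Finset.sum_const, nsmul_eq_mul, ← ENNReal.ofReal_natCast,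
          ← ENNReal.ofReal_mul (by positivity), ← ENNReal.ofReal_mul (by positivity)]
        simp
    _ ≤ ENNReal.ofReal (((2 : ℝ) ^ (n * β)) ^ p * ((6 ^ d * ((2 : ℝ) ^ n) ^ d) * B)) := by
        gcongr
    _ = _ := by
        congr 1
        have e : ((2 : ℝ) ^ (β * p - ε)) ^ n =
            ((2 : ℝ) ^ (n * β)) ^ p * ((2 : ℝ) ^ n) ^ d * ((2 : ℝ) ^ (-((d : ℝ) + ε))) ^ n := by
          simp only [← Real.rpow_natCast, ← Real.rpow_mul (zero_le_two (α := ℝ))]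
          rw [← Real.rpow_add two_pos, ← Real.rpow_add two_pos]
          ring_nf
        rw [e, hB]
        ring

lemma measurableSet_badSet (hX : ∀ t, Measurable (X t)) (t : Fin d → ℝ) :
    MeasurableSet (badSet X p t) :=
  (Measurable.tsum fun _ => measurable_increment hX _ _) (measurableSet_singleton ⊤)

lemma measure_badSet (hX : ∀ t, Measurable (X t)) (hC : 0 < C) (hε : 0 < ε) {P : Measure Ω}
    (hkol : ∀ s t : Fin d → ℝ, (∀ i, s i ∈ Set.Icc (0 : ℝ) 1) →
      (∀ i, t i ∈ Set.Icc (0 : ℝ) 1) →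
      ∫⁻ ω, ENNReal.ofReal (|X t ω - X s ω| ^ p) ∂P ≤
        ENNReal.ofReal (C * euclDist s t ^ ((d : ℝ) + ε)))
    {t : Fin d → ℝ} (ht : ∀ i, t i ∈ Set.Icc (0 : ℝ) 1) : P (badSet X p t) = 0 := by
  have hm := measurable_increment (p := p) hX
  refine measure_eq_top_of_lintegral_ne_top
    (Measurable.tsum fun _ => hm _ _).aemeasurable ?_
  rw [lintegral_tsum fun n => (hm _ _).aemeasurable]
  refine ne_top_of_le_ne_top ?_ (ENNReal.tsum_le_tsum fun n =>
    lintegral_increment_le hC hε hkol ht (gridPt_mem (gridFloor_le ht n))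
      (abs_sub_gridPt_gridFloor_le ht n))
  have hlt : (2 : ℝ) ^ (-((d : ℝ) + ε)) < 1 := two_rpow_neg_lt_one (by positivity)
  rw [← ENNReal.ofReal_tsum_of_nonneg (fun n => by positivity)
    ((summable_geometric_of_lt_one (by positivity) hlt).mul_left _)]
  exact ENNReal.ofReal_ne_top

end Measure

end Kolmogorov

open Kolmogorov

/-- **Kolmogorov criterion under a family of probabilities.** Let `Ps` be
a nonempty family of Borel probability measures on a complete separable metric space `Ω`,
with upper expectation `𝔼[Z] = sup_{P ∈ Ps} E_P[Z]` and capacity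
`c(A) = sup_{P ∈ Ps} P(A)`. Let `p > 0` and `(X_t)_{t ∈ [0,1]^d}` with each `X_t` Borel,
`𝔼[|X_t|^p] < ∞`, and `𝔼[|X_t - X_s|^p] ≤ C |t-s|^{d+ε}` (Euclidean distance) for some
constants `C, ε > 0`. Then `X` admits a quasi-modification `Y` such that for every
`α ∈ [0, ε/p)` the moment `𝔼[(sup_{s ≠ t} |Y_t - Y_s|/|t-s|^α)^p]` is finite, and there
is a polar Borel set `N` such that for every `ω ∉ N` the path `t ↦ Y t ω` is Hölder
continuous of order `α` for every `α < ε/p`. -/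
theorem kolmogorov_criterion_upper_expectation
    {Ω : Type*} [MetricSpace Ω] [CompleteSpace Ω] [TopologicalSpace.SeparableSpace Ω]
    [MeasurableSpace Ω] [BorelSpace Ω]
    (Ps : Set (ProbabilityMeasure Ω)) (hPs : Ps.Nonempty)
    (p : ℝ) (hp : 0 < p) (d : ℕ)
    (X : (Fin d → ℝ) → Ω → ℝ)
    (hXmeas : ∀ t, Measurable (X t))
    (hXfin : ∀ t : Fin d → ℝ, (∀ i, t i ∈ Set.Icc (0 : ℝ) 1) →
      (⨆ P ∈ Ps, ∫⁻ ω, ENNReal.ofReal (|X t ω| ^ p) ∂(P : Measure Ω)) < ⊤)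
    (C ε : ℝ) (hC : 0 < C) (hε : 0 < ε)
    (hkol : ∀ s t : Fin d → ℝ, (∀ i, s i ∈ Set.Icc (0 : ℝ) 1) →
      (∀ i, t i ∈ Set.Icc (0 : ℝ) 1) →
      (⨆ P ∈ Ps, ∫⁻ ω, ENNReal.ofReal (|X t ω - X s ω| ^ p) ∂(P : Measure Ω)) ≤
        ENNReal.ofReal (C * Real.sqrt (∑ i, (t i - s i) ^ 2) ^ ((d : ℝ) + ε))) :
    ∃ Y : (Fin d → ℝ) → Ω → ℝ,
      -- `Y` is a quasi-modification of `X` on `[0,1]^d`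
      (∀ t : Fin d → ℝ, (∀ i, t i ∈ Set.Icc (0 : ℝ) 1) →
        ∃ N : Set Ω, MeasurableSet N ∧ (⨆ P ∈ Ps, (P : Measure Ω) N) = 0 ∧
          ∀ ω ∉ N, X t ω = Y t ω) ∧
      -- finiteness of the `p`-th moment of the `α`-Hölder constant, for `α ∈ [0, ε/p)`
      (∀ α : ℝ, 0 ≤ α → α < ε / p →
        (⨆ P ∈ Ps, ∫⁻ ω,
          (⨆ (s : Fin d → ℝ) (t : Fin d → ℝ) (_ : ∀ i, s i ∈ Set.Icc (0 : ℝ) 1)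
              (_ : ∀ i, t i ∈ Set.Icc (0 : ℝ) 1) (_ : s ≠ t),
            ENNReal.ofReal
              ((|Y t ω - Y s ω| / Real.sqrt (∑ i, (t i - s i) ^ 2) ^ α) ^ p))
          ∂(P : Measure Ω)) < ⊤) ∧
      -- quasi-sure Hölder continuity of the paths of `Y` of every order `α < ε/p`
      (∃ N : Set Ω, MeasurableSet N ∧ (⨆ P ∈ Ps, (P : Measure Ω) N) = 0 ∧
        ∀ ω ∉ N, ∀ α : ℝ, 0 ≤ α → α < ε / p →
          ∃ C' : ℝ, ∀ s t : Fin d → ℝ, (∀ i, s i ∈ Set.Icc (0 : ℝ) 1) →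
            (∀ i, t i ∈ Set.Icc (0 : ℝ) 1) →
            |Y t ω - Y s ω| ≤ C' * Real.sqrt (∑ i, (t i - s i) ^ 2) ^ α) := by
  have hkol' : ∀ P ∈ Ps, ∀ s t : Fin d → ℝ, (∀ i, s i ∈ Set.Icc (0 : ℝ) 1) →
      (∀ i, t i ∈ Set.Icc (0 : ℝ) 1) →
      ∫⁻ ω, ENNReal.ofReal (|X t ω - X s ω| ^ p) ∂(P : Measure Ω) ≤
        ENNReal.ofReal (C * euclDist s t ^ ((d : ℝ) + ε)) := fun P hP s t hs ht =>
    (le_iSup₂ (f := fun (P : ProbabilityMeasure Ω) (_ : P ∈ Ps) =>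
      ∫⁻ ω, ENNReal.ofReal (|X t ω - X s ω| ^ p) ∂(P : Measure Ω)) P hP).trans (hkol s t hs ht)
  have hεp : 0 < ε / p := div_pos hε hp
  refine ⟨fun t ω => dyadicLim (fun s => X s ω) t, fun t ht => ?_, fun α hα0 hα => ?_, ?_⟩
  · refine ⟨badSet X p t, measurableSet_badSet hXmeas t, ?_,
      fun ω hω => eq_dyadicLim_of_notMem_badSet hp hω⟩
    simp only [ENNReal.iSup_eq_zero]
    exact fun P hP => measure_badSet hXmeas hC hε (hkol' P hP) ht
  · obtain ⟨β, hαβ, hβ⟩ := exists_between hα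
    have hβ0 : 0 < β := hα0.trans_lt hαβ
    refine lt_of_le_of_lt (iSup₂_le fun P hP => ?_)
      (ENNReal.mul_lt_top (ENNReal.ofReal_lt_top
        (r := (chainConst β * (Real.sqrt d + 1) ^ (β - α)) ^ p))
        (incrementBound_lt_top (d := d) (C := C) hp hC hβ))
    grw [← lintegral_incrementSum_le hXmeas hC hε (hkol' P hP) β,
      ← lintegral_const_mul _ (measurable_incrementSum hXmeas β)]
    refine lintegral_mono fun ω => ?_
    simp only [iSup_le_iff]
    exact fun s t hs ht hst => ofReal_ratio_le hp hβ0 hαβ.le _ hs ht hst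
  · obtain ⟨b, -, hb, hb_lim⟩ := exists_seq_strictMono_tendsto' hεp
    refine ⟨⋃ m, {ω | incrementSum p (b m) (fun t => X t ω) = ⊤},
      MeasurableSet.iUnion fun m =>
        measurable_incrementSum hXmeas (b m) (measurableSet_singleton ⊤), ?_, ?_⟩
    · simp only [ENNReal.iSup_eq_zero]
      refine fun P hP => measure_iUnion_null fun m => ?_
      exact measure_eq_top_of_lintegral_ne_top (measurable_incrementSum hXmeas _).aemeasurable
        ((lintegral_incrementSum_le hXmeas hC hε (hkol' P hP) _).trans_lt
          (incrementBound_lt_top hp hC (hb m).2)).ne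
    · intro ω hω α _ hα
      obtain ⟨m, hm⟩ := (hb_lim.eventually_const_lt hα).exists
      have hS : incrementSum p (b m) (fun t => X t ω) ≠ ⊤ := fun h => hω (Set.mem_iUnion.mpr ⟨m, h⟩)
      have hc := chainConst_pos (hb m).1
      refine ⟨chainConst (b m) * (Real.sqrt d + 1) ^ (b m - α) *
        (incrementSum p (b m) fun t => X t ω).toReal ^ p⁻¹, fun s t hs ht => ?_⟩
      rcases eq_or_ne s t with rfl | hst
      · rw [sub_self, abs_zero]
        positivity
      · exact abs_dyadicLim_sub_le' hp (hb m).1 hm.le hS hs ht hst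
end
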